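/- Let T be a finite bicentroidal tree one of whose centroidal components is a path P_k while the other centroidal component is not a pseudopath. Then ern(T) = 2. -/

import Mathlib

open SimpleGraph

namespace ErnPaper

/-- The weight of a vertex `v` in a graph `G`: the number of vertices in a largest
connected component of `G - v`. -/
noncomputable def wt {V : Type} [Fintype V] (G : SimpleGraph V) (v : V) : ℕ :=
  sSup {n | ∃ c : (G.induce ({v}ᶜ : Set V)).ConnectedComponent, n = Nat.card c.supp}

/-- The centroid of a graph: the set of vertices of minimum weight. -/
def centroid {V : Type} [Fintype V] (G : SimpleGraph V) : Set V :=
  {v | ∀ u, wt G v ≤ wt G u}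

/-- The edge-reconstruction number of a finite graph `G`: the least `k` for which there exist
`k` distinct edges `e₁, …, e_k` of `G` such that any finite graph `H` having `k` distinct
edges `f₁, …, f_k` with `H - fᵢ ≅ G - eᵢ` for all `i` must be isomorphic to `G`. -/
noncomputable def ern {V : Type} [Fintype V] (G : SimpleGraph V) : ℕ :=
  sInf {k | ∃ s : Finset (Sym2 V), s.card = k ∧ (↑s : Set (Sym2 V)) ⊆ G.edgeSet ∧
    ∀ (W : Type) (_ : Fintype W) (H : SimpleGraph W) (t : Finset (Sym2 W)),
      (↑t : Set (Sym2 W)) ⊆ H.edgeSet →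
      (∃ φ : {e // e ∈ s} ≃ {f // f ∈ t},
        ∀ e : {e // e ∈ s},
          Nonempty (H.deleteEdges {(φ e).1} ≃g G.deleteEdges {e.1})) →
      Nonempty (H ≃g G)}

/-- The spider tree `S_{p,q,r}`: three paths with `p`, `q`, `r` edges respectively,
emanating from a common central vertex. -/
def spider (p q r : ℕ) : SimpleGraph (Unit ⊕ (Fin p ⊕ Fin q ⊕ Fin r)) :=
  SimpleGraph.fromRel fun x y =>
    match x, y with
    | Sum.inl _, Sum.inr (Sum.inl j) => (j : ℕ) = 0
    | Sum.inl _, Sum.inr (Sum.inr (Sum.inl j)) => (j : ℕ) = 0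
    | Sum.inl _, Sum.inr (Sum.inr (Sum.inr j)) => (j : ℕ) = 0
    | Sum.inr (Sum.inl i), Sum.inr (Sum.inl j) => (j : ℕ) = (i : ℕ) + 1
    | Sum.inr (Sum.inr (Sum.inl i)), Sum.inr (Sum.inr (Sum.inl j)) => (j : ℕ) = (i : ℕ) + 1
    | Sum.inr (Sum.inr (Sum.inr i)), Sum.inr (Sum.inr (Sum.inr j)) => (j : ℕ) = (i : ℕ) + 1
    | _, _ => False

/-- A pseudopath: a tree isomorphic to a path `P_k`, to `S_{1,1,2}`, or to `S_{1,2,3}`. -/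
def IsPseudopath {V : Type} (T : SimpleGraph V) : Prop :=
  (∃ k, Nonempty (T ≃g pathGraph k)) ∨
    Nonempty (T ≃g spider 1 1 2) ∨ Nonempty (T ≃g spider 1 2 3)

/-- `T - xv + yv`: delete the end-edge `xv` and add the new edge `yv`. -/
def replaceEdge {V : Type} (T : SimpleGraph V) (x v y : V) : SimpleGraph V :=
  SimpleGraph.fromEdgeSet ((T.edgeSet \ {s(x, v)}) ∪ {s(y, v)})

/-- The disjoint union of two simple graphs. -/
def disjUnion {α β : Type} (G : SimpleGraph α) (H : SimpleGraph β) :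
    SimpleGraph (α ⊕ β) :=
  SimpleGraph.fromRel fun x y =>
    match x, y with
    | Sum.inl a, Sum.inl b => G.Adj a b
    | Sum.inr a, Sum.inr b => H.Adj a b
    | _, _ => False

/-- The caterpillar `C(2,0,…,0,2)` with spine on `m` vertices: spine path `v₀ … v_{m-1}`,
with two extra endvertices adjacent to `v₀` and two to `v_{m-1}`. -/
def doubleBroom (m : ℕ) : SimpleGraph (Fin m ⊕ Fin 4) :=
  SimpleGraph.fromRel fun x y =>
    match x, y with
    | Sum.inl i, Sum.inl j => (j : ℕ) = (i : ℕ) + 1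
    | Sum.inl i, Sum.inr l =>
        ((i : ℕ) = 0 ∧ (l : ℕ) < 2) ∨ ((i : ℕ) = m - 1 ∧ 2 ≤ (l : ℕ))
    | _, _ => False


/-- Concrete rooted trees with coloured vertices; `join A B` attaches the root of `B` as a new
child of the root of `A`. -/
inductive Pre (α : Type) : Type
  | one (c : α) : Pre α
  | join (A B : Pre α) : Pre α

/-- One elementary reordering of children. -/
inductive Pre.Rel {α : Type} : Pre α → Pre α → Prop
  | swap (A B C : Pre α) : Pre.Rel (.join (.join A B) C) (.join (.join A C) B)
  | left {A A' : Pre α} (B : Pre α) : Pre.Rel A A' → Pre.Rel (.join A B) (.join A' B)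
  | right (A : Pre α) {B B' : Pre α} : Pre.Rel B B' → Pre.Rel (.join A B) (.join A B')

/-- Rooted coloured trees up to isomorphism. -/
def RT (α : Type) : Type := Quot (Pre.Rel (α := α))

namespace RT

variable {α : Type}

def mk (p : Pre α) : RT α := Quot.mk _ p

def one (c : α) : RT α := mk (.one c)

def join (A B : RT α) : RT α :=
  Quot.map₂ Pre.join (fun A _ _ h => Pre.Rel.right A h) (fun _ _ B h => Pre.Rel.left B h) A B

theorem mk_join (p q : Pre α) : mk (.join p q) = join (mk p) (mk q) := rfl

theorem join_swap (A B C : RT α) : join (join A B) C = join (join A C) B := by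
  induction A using Quot.ind
  induction B using Quot.ind
  induction C using Quot.ind
  exact Quot.sound (Pre.Rel.swap _ _ _)

theorem ind {P : RT α → Prop} (h1 : ∀ c, P (one c)) (h2 : ∀ A B, P A → P B → P (join A B))
    (R : RT α) : P R := by
  induction R using Quot.ind with
  | mk p =>
    induction p with
    | one c => exact h1 c
    | join A B ha hb => exact h2 _ _ ha hb

def preBr : Pre α → Multiset (RT α)
  | .one _ => 0
  | .join A B => mk B ::ₘ preBr A

theorem preBr_rel {p q : Pre α} (h : Pre.Rel p q) : preBr p = preBr q := by
  induction h with
  | swap A B C => exact Multiset.cons_swap _ _ _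
  | left B _ ih => simp [preBr, ih]
  | right A h _ =>
    have := Quot.sound h
    simp only [preBr]
    congr 1

/-- The multiset of branches at the root. -/
def br (R : RT α) : Multiset (RT α) := Quot.lift preBr (fun _ _ h => preBr_rel h) R

def preCol : Pre α → α
  | .one c => c
  | .join A _ => preCol A

theorem preCol_rel {p q : Pre α} (h : Pre.Rel p q) : preCol p = preCol q := by
  induction h with
  | swap A B C => rfl
  | left B _ ih => simpa [preCol] using ih
  | right A h _ => rfl

/-- The colour of the root. -/
def col (R : RT α) : α := Quot.lift preCol (fun _ _ h => preCol_rel h) R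

def preMu (w : α → ℕ) : Pre α → ℕ
  | .one c => w c
  | .join A B => preMu w A + preMu w B

theorem preMu_rel (w : α → ℕ) {p q : Pre α} (h : Pre.Rel p q) : preMu w p = preMu w q := by
  induction h with
  | swap A B C => simp [preMu]; omega
  | left B _ ih => simp [preMu, ih]
  | right A h ih => simp [preMu, ih]

/-- Total weight. -/
def mu (w : α → ℕ) (R : RT α) : ℕ := Quot.lift (preMu w) (fun _ _ h => preMu_rel w h) R

/-- Number of vertices. -/
def sz (R : RT α) : ℕ := mu (fun _ => 1) R

def preMap {β : Type} (g : α → β) : Pre α → Pre β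
  | .one c => .one (g c)
  | .join A B => .join (preMap g A) (preMap g B)

theorem preMap_rel {β : Type} (g : α → β) {p q : Pre α} (h : Pre.Rel p q) :
    Pre.Rel (preMap g p) (preMap g q) := by
  induction h with
  | swap A B C => exact Pre.Rel.swap _ _ _
  | left B _ ih => exact Pre.Rel.left _ ih
  | right A h ih => exact Pre.Rel.right _ ih

/-- Recolouring. -/
def map {β : Type} (g : α → β) (R : RT α) : RT β :=
  Quot.map (preMap g) (fun _ _ h => preMap_rel g h) R

/-- The underlying uncoloured tree. -/
def sh (R : RT α) : RT Unit := map (fun _ => ()) R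

@[simp] theorem br_one (c : α) : br (one c) = 0 := rfl
@[simp] theorem br_join (A B : RT α) : br (join A B) = B ::ₘ br A := by
  induction A using Quot.ind
  induction B using Quot.ind
  rfl
@[simp] theorem col_one (c : α) : col (one c) = c := rfl
@[simp] theorem col_join (A B : RT α) : col (join A B) = col A := by
  induction A using Quot.ind
  induction B using Quot.ind
  rfl
@[simp] theorem mu_one (w : α → ℕ) (c : α) : mu w (one c) = w c := rfl
@[simp] theorem mu_join (w : α → ℕ) (A B : RT α) : mu w (join A B) = mu w A + mu w B := by
  induction A using Quot.ind
  induction B using Quot.ind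
  rfl
@[simp] theorem sz_one (c : α) : sz (one c) = 1 := rfl
@[simp] theorem sz_join (A B : RT α) : sz (join A B) = sz A + sz B := mu_join _ A B
@[simp] theorem map_one {β : Type} (g : α → β) (c : α) : map g (one c) = one (g c) := rfl
@[simp] theorem map_join {β : Type} (g : α → β) (A B : RT α) :
    map g (join A B) = join (map g A) (map g B) := by
  induction A using Quot.ind
  induction B using Quot.ind
  rfl
@[simp] theorem sh_one (c : α) : sh (one c) = one () := rfl
@[simp] theorem sh_join (A B : RT α) : sh (join A B) = join (sh A) (sh B) := map_join _ A B

theorem sz_pos (R : RT α) : 0 < sz R := by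
  induction R using ind with
  | h1 c => simp
  | h2 A B ha hb => simp; omega

theorem one_or_join (R : RT α) : (∃ c, R = one c) ∨ ∃ A B, R = join A B := by
  induction R using ind with
  | h1 c => exact Or.inl ⟨c, rfl⟩
  | h2 A B _ _ => exact Or.inr ⟨A, B, rfl⟩

theorem join_ne_one (A B : RT α) (c : α) : join A B ≠ one c := by
  intro h
  have := congrArg br h
  simp at this

theorem exists_join_of_mem (R B : RT α) (h : B ∈ br R) : ∃ A, R = join A B := by
  induction R using ind with
  | h1 c => simp at h
  | h2 C D hc hd =>
    simp only [br_join, Multiset.mem_cons] at h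
    rcases h with h | h
    · exact ⟨C, by rw [h]⟩
    · obtain ⟨E, rfl⟩ := hc h
      exact ⟨join E D, join_swap _ _ _⟩

theorem mem_br_join (A B : RT α) : B ∈ br (join A B) := by simp

theorem ext (R : RT α) : ∀ S : RT α, col R = col S → br R = br S → R = S := by
  induction R using ind with
  | h1 c =>
    intro S hc hb
    rcases one_or_join S with ⟨d, rfl⟩ | ⟨A, B, rfl⟩
    · simp at hc; rw [hc]
    · simp at hb
  | h2 C D hC hD =>
    intro S hc hb
    have hm : D ∈ br S := by rw [← hb]; simp
    obtain ⟨A, rfl⟩ := exists_join_of_mem S D hm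
    simp at hb hc
    rw [hC A hc hb]

theorem join_left_cancel {A B C : RT α} (h : join A B = join A C) : B = C := by
  have := congrArg br h
  simp only [br_join] at this
  rwa [Multiset.cons_inj_left] at this

theorem join_right_cancel {A B C : RT α} (h : join A C = join B C) : A = B := by
  have h1 := congrArg br h
  have h2 := congrArg col h
  simp only [br_join, col_join, Multiset.cons_inj_right] at h1 h2
  exact ext _ _ h2 h1

theorem join_eq {A B C D : RT α} (h : join A B = join C D) :
    (A = C ∧ B = D) ∨ ∃ E, A = join E D ∧ C = join E B := by
  by_cases hBD : B = D
  · subst hBD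
    exact Or.inl ⟨join_right_cancel h, rfl⟩
  · right
    have h1 := congrArg br h
    simp only [br_join] at h1
    have hD : D ∈ br A := by
      have : D ∈ B ::ₘ br A := by rw [h1]; simp
      rcases Multiset.mem_cons.1 this with h | h
      · exact absurd h.symm hBD
      · exact h
    obtain ⟨E, rfl⟩ := exists_join_of_mem A D hD
    refine ⟨E, rfl, ?_⟩
    rw [join_swap] at h
    exact (join_right_cancel h).symm

theorem join_eq_up {A B Q : RT α} {c : α} (h : join A B = join (one c) Q) :
    A = one c ∧ B = Q := by
  rcases join_eq h with h | ⟨E, _, h⟩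
  · exact h
  · exact absurd h.symm (join_ne_one _ _ _)

theorem one_inj {c d : α} (h : one c = one d) : c = d := by
  simpa using congrArg col h

theorem sz_eq_one {R : RT α} (h : sz R = 1) : ∃ c, R = one c := by
  rcases one_or_join R with h1 | ⟨A, B, rfl⟩
  · exact h1
  · have := sz_pos A; have := sz_pos B; simp at h; omega

/-- Degree of the root. -/
def deg (R : RT α) : ℕ := Multiset.card (br R)
@[simp] theorem deg_one (c : α) : deg (one c) = 0 := rfl
@[simp] theorem deg_join (A B : RT α) : deg (join A B) = deg A + 1 := by simp [deg]

@[simp] theorem deg_sh (R : RT α) : deg (sh R) = deg R := by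
  induction R using ind with
  | h1 c => simp
  | h2 A B ha hb => simp [ha]
@[simp] theorem sz_sh (R : RT α) : sz (sh R) = sz R := by
  induction R using ind with
  | h1 c => simp
  | h2 A B ha hb => simp [ha, hb]

theorem sh_eq_join {R : RT α} : ∀ {a b : RT Unit}, sh R = join a b →
    ∃ A B, R = join A B ∧ sh A = a ∧ sh B = b := by
  induction R using ind with
  | h1 c => intro a b h; exact absurd h.symm (join_ne_one _ _ _)
  | h2 A B ha hb =>
    intro a b h
    rw [sh_join] at h
    rcases join_eq h with ⟨h1, h2⟩ | ⟨E, h1, h2⟩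
    · exact ⟨A, B, rfl, h1, h2⟩
    · obtain ⟨A1, A2, rfl, h3, h4⟩ := ha h1
      exact ⟨join A1 B, A2, join_swap _ _ _, by rw [sh_join, h3, h2], h4⟩

theorem sh_eq_one {R : RT α} (h : sh R = one ()) : ∃ c, R = one c := by
  apply sz_eq_one
  rw [← sz_sh, h, sz_one]

/-! ### Rerooting -/

def Step (R S : RT α) : Prop := ∃ A B, R = join A B ∧ S = join B A

/-- Equality of unrooted trees. -/
def U (R S : RT α) : Prop := Relation.ReflTransGen Step R S

theorem U.refl (R : RT α) : U R R := Relation.ReflTransGen.refl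
theorem U.trans {R S T : RT α} (h : U R S) (h' : U S T) : U R T := Relation.ReflTransGen.trans h h'
theorem U.swap (A B : RT α) : U (join A B) (join B A) :=
  Relation.ReflTransGen.single ⟨A, B, rfl, rfl⟩
theorem U.symm {R S : RT α} (h : U R S) : U S R := by
  induction h with
  | refl => exact U.refl _
  | tail _ h ih =>
    obtain ⟨A, B, rfl, rfl⟩ := h
    exact (U.swap _ _).trans ih
theorem U.of_eq {R S : RT α} (h : R = S) : U R S := h ▸ U.refl R

theorem U.mu {w : α → ℕ} {R S : RT α} (h : U R S) : mu w R = mu w S := by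
  induction h with
  | refl => rfl
  | tail _ h ih =>
    obtain ⟨A, B, rfl, rfl⟩ := h
    rw [ih]; simp; omega
theorem U.sz {R S : RT α} (h : U R S) : sz R = sz S := U.mu h

theorem U.map {β : Type} (g : α → β) {R S : RT α} (h : U R S) : U (map g R) (map g S) := by
  induction h with
  | refl => exact U.refl _
  | tail _ h ih =>
    obtain ⟨A, B, rfl, rfl⟩ := h
    refine ih.trans ?_
    simp only [map_join]
    exact U.swap _ _
theorem U.sh {R S : RT α} (h : U R S) : U (sh R) (sh S) := U.map _ h

/-- Lifting of rerootings to coloured trees. -/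
theorem U.lift {R : RT α} {s : RT Unit} (h : U (RT.sh R) s) : ∃ S, U R S ∧ RT.sh S = s := by
  induction h with
  | refl => exact ⟨R, U.refl _, rfl⟩
  | tail _ h ih =>
    obtain ⟨S, h1, h2⟩ := ih
    obtain ⟨a, b, rfl, rfl⟩ := h
    obtain ⟨A, B, rfl, rfl, rfl⟩ := sh_eq_join h2
    exact ⟨join B A, h1.trans (U.swap _ _), by simp⟩

/-- `Desc K B S`: `S` is obtained by moving the root into the branch `B`, whose context is `K`. -/
inductive Desc : RT α → RT α → RT α → Prop
  | here (K B : RT α) : Desc K B (join B K)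
  | there (K B1 B2 : RT α) {S : RT α} : Desc (join B1 K) B2 S → Desc K (join B1 B2) S

theorem Desc.step {K B S : RT α} (h : Desc K B S) : ∀ {X Y : RT α}, S = join X Y →
    join Y X = join K B ∨ Desc K B (join Y X) := by
  induction h with
  | here K B =>
    intro X Y h
    rcases join_eq h with ⟨rfl, rfl⟩ | ⟨E, rfl, rfl⟩
    · exact Or.inl rfl
    · exact Or.inr (Desc.there _ _ _ (Desc.here _ _))
  | there K B1 B2 h ih =>
    intro X Y h'
    rcases ih h' with h1 | h1
    · right
      rw [h1, join_swap]
      exact Desc.here _ _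
    · exact Or.inr (Desc.there _ _ _ h1)

theorem U.desc {R S : RT α} (h : U R S) : R = S ∨ ∃ A B, R = join A B ∧ Desc A B S := by
  induction h with
  | refl => exact Or.inl rfl
  | tail _ h ih =>
    obtain ⟨X, Y, rfl, rfl⟩ := h
    rcases ih with rfl | ⟨A, B, rfl, h1⟩
    · exact Or.inr ⟨X, Y, rfl, Desc.here _ _⟩
    · rcases h1.step rfl with h2 | h2
      · exact Or.inl h2.symm
      · exact Or.inr ⟨A, B, rfl, h2⟩

theorem Desc.big {K B S : RT α} (h : Desc K B S) : S = join B K ∨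
    ∃ C X, S = join C X ∧ sz K < sz X ∧ ∀ w : α → ℕ, mu w K ≤ mu w X := by
  induction h with
  | here K B => exact Or.inl rfl
  | there K B1 B2 h ih =>
    right
    rcases ih with rfl | ⟨C, X, rfl, h1, h2⟩
    · refine ⟨_, _, rfl, ?_, fun w => ?_⟩
      · have := sz_pos B1; simp; omega
      · simp
    · refine ⟨_, _, rfl, ?_, fun w => ?_⟩
      · simp at h1; omega
      · have := h2 w; simp at this; omega

/-- The root is a centroidal vertex. -/
def Cen (R : RT α) : Prop := ∀ A B, R = join A B → sz B ≤ sz A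
/-- The root is the unique centroidal vertex. -/
def SCen (R : RT α) : Prop := ∀ A B, R = join A B → sz B < sz A

theorem SCen.cen {R : RT α} (h : SCen R) : Cen R := fun A B e => (h A B e).le

theorem Cen.sh {R : RT α} (h : Cen R) : Cen (sh R) := by
  intro a b e
  obtain ⟨A, B, rfl, rfl, rfl⟩ := sh_eq_join e
  simpa using h A B rfl
theorem SCen.sh {R : RT α} (h : SCen R) : SCen (RT.sh R) := by
  intro a b e
  obtain ⟨A, B, rfl, rfl, rfl⟩ := sh_eq_join e
  simpa using h A B rfl

theorem cen_join {A B : RT α} (h1 : sz B ≤ sz A) (h2 : ∀ E D, A = join E D → sz D ≤ sz E + sz B) :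
    Cen (join A B) := by
  intro C D h
  rcases join_eq h with ⟨rfl, rfl⟩ | ⟨E, rfl, rfl⟩
  · exact h1
  · simpa using h2 E D rfl

theorem cen_uniq {R S : RT α} (h : U R S) (hR : Cen R) (hS : Cen S) :
    R = S ∨ ∃ A B, R = join A B ∧ S = join B A ∧ sz A = sz B := by
  have hs := U.sz h
  rcases h.desc with h | ⟨A, B, rfl, h'⟩
  · exact Or.inl h
  · right
    have h1 := hR A B rfl
    rcases h'.big with rfl | ⟨C, X, rfl, h2, _⟩
    · exact ⟨A, B, rfl, rfl, le_antisymm (hS _ _ rfl) h1⟩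
    · have h3 := hS _ _ rfl
      simp at hs
      omega

theorem uni {R S : RT α} (h : U R S) (hR : Cen R) (hS : SCen S) : R = S := by
  rcases cen_uniq h hR hS.cen with h | ⟨A, B, rfl, rfl, h1⟩
  · exact h
  · have := hS _ _ rfl
    omega

theorem cen_half {A B : RT α} (h : sz A = sz B) : Cen (join A B) := by
  refine cen_join h.ge ?_
  intro E D hA
  have h1 : sz A = sz E + sz D := by rw [hA, sz_join]
  omega

theorem half {R C D : RT α} (h : U R (join C D)) (hR : Cen R) (hs : sz C = sz D) :
    R = join C D ∨ R = join D C := by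
  rcases cen_uniq h hR (cen_half hs) with h | ⟨A, B, rfl, h1, h2⟩
  · exact Or.inl h
  · right
    rcases join_eq h1 with ⟨rfl, rfl⟩ | ⟨E, rfl, rfl⟩
    · rfl
    · have := sz_pos E
      simp only [sz_join] at hs h2; omega

theorem half_join {X Y C D : RT α} (h : join X Y = join C D) (h1 : sz X = sz Y) (h2 : sz C = sz D) :
    X = C ∧ Y = D := by
  rcases join_eq h with h | ⟨E, rfl, rfl⟩
  · exact h
  · simp at h1 h2; have := sz_pos E; omega

theorem bic {A B C D : RT α} (h : U (join A B) (join C D)) (h1 : sz A = sz B) (h2 : sz C = sz D) :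
    (A = C ∧ B = D) ∨ (A = D ∧ B = C) := by
  rcases half h (cen_half h1) h2 with h | h
  · exact Or.inl (half_join h h1 h2)
  · exact Or.inr (half_join h h1 h2.symm)

/-- Existence of a centroidal rerooting. -/
theorem exists_cen_aux : ∀ n, ∀ A B : RT α, sz B ≤ n → sz A < sz B → ∃ C, U (join A B) C ∧ Cen C := by
  intro n
  induction n with
  | zero => intro A B h; have := sz_pos B; omega
  | succ n ih =>
    intro A B h hAB
    by_cases hc : ∀ E D, B = join E D → sz D ≤ sz E + sz A
    · exact ⟨join B A, U.swap _ _, cen_join hAB.le hc⟩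
    · push Not at hc
      obtain ⟨E, D, rfl, h1⟩ := hc
      obtain ⟨C, h2, h3⟩ := ih (join E A) D (by have := sz_pos E; simp at h; omega)
        (by simpa using h1)
      refine ⟨C, (U.swap _ _).trans ?_, h3⟩
      rw [join_swap]
      exact h2

theorem exists_cen (R : RT α) : ∃ C, U R C ∧ Cen C := by
  by_cases h : Cen R
  · exact ⟨R, U.refl _, h⟩
  · unfold Cen at h
    push Not at h
    obtain ⟨A, B, rfl, h1⟩ := h
    exact exists_cen_aux _ A B le_rfl h1

/-- Trees whose root carries the whole weight `1` are determined by their unrooted class. -/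
theorem mark_uniq (w : α → ℕ) {R S : RT α} (h : U R S) (hR : mu w R = 1) (hRc : w (col R) = 1)
    (hSc : w (col S) = 1) : R = S := by
  have key : ∀ T : RT α, w (col T) ≤ mu w T := by
    intro T
    induction T using ind with
    | h1 c => simp
    | h2 A B ha hb => simp; omega
  rcases h.desc with h | ⟨A, B, rfl, h'⟩
  · exact h
  · exfalso
    have hS := h.mu (w := w)
    have hA := key A
    simp at hR hRc
    rcases h'.big with rfl | ⟨C, X, rfl, _, h2⟩
    · have hB := key B
      simp at hSc; omega
    · have hC := key C
      have := h2 w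
      simp at hSc hS; omega

/-! ### Attaching a branch -/

/-- `Att X F Y`: `Y` is obtained from `F` by attaching the branch `X` at some vertex. -/
inductive Att (X : RT α) : RT α → RT α → Prop
  | root (F : RT α) : Att X F (join F X)
  | sub (A : RT α) {B B' : RT α} : Att X B B' → Att X (join A B) (join A B')

theorem Att.sz {X F Y : RT α} (h : Att X F Y) : sz Y = sz F + sz X := by
  induction h with
  | root F => simp
  | sub A _ ih => simp [ih]; omega

theorem Att.left {X A A' : RT α} (B : RT α) (h : Att X A A') : Att X (join A B) (join A' B) := by
  cases h with
  | root => rw [join_swap]; exact Att.root _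
  | sub C h =>
    rw [join_swap C _ B, join_swap C _ B]
    exact Att.sub _ h

theorem Att.inv {X A B Y : RT α} (h : Att X (join A B) Y) :
    (∃ A', Att X A A' ∧ Y = join A' B) ∨ ∃ B', Att X B B' ∧ Y = join A B' := by
  generalize hF : join A B = F at h
  cases h with
  | root =>
    subst hF
    exact Or.inl ⟨join A X, Att.root _, join_swap _ _ _⟩
  | sub C h =>
    rcases join_eq hF with ⟨rfl, rfl⟩ | ⟨E, rfl, rfl⟩
    · exact Or.inr ⟨_, h, rfl⟩
    · exact Or.inl ⟨_, Att.sub E h, join_swap _ _ _⟩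

theorem Att.inv_one {X Y : RT α} {c : α} (h : Att X (one c) Y) : Y = join (one c) X := by
  generalize hF : one c = F at h
  cases h with
  | root => rfl
  | sub C h => exact absurd hF.symm (join_ne_one _ _ _)

theorem Att.cases' {X F Y : RT α} (h : Att X F Y) :
    Y = join F X ∨ ∃ A B B', F = join A B ∧ Y = join A B' ∧ Att X B B' := by
  cases h with
  | root => exact Or.inl rfl
  | sub C h => exact Or.inr ⟨_, _, _, rfl, rfl, h⟩

theorem Att.ne_one {X F : RT α} {c : α} (h : Att X F (one c)) : False := by
  have h1 := h.sz
  have := sz_pos F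
  have := sz_pos X
  simp at h1; omega

theorem Att.to_up {X F Q : RT α} {c : α} (h : Att X F (join (one c) Q)) :
    (F = one c ∧ Q = X) ∨ ∃ F1, F = join (one c) F1 ∧ Att X F1 Q := by
  rcases h.cases' with h1 | ⟨A, B, B', rfl, h1, h2⟩
  · obtain ⟨h2, h3⟩ := join_eq_up h1.symm
    exact Or.inl ⟨h2, h3.symm⟩
  · obtain ⟨h3, h4⟩ := join_eq_up h1.symm
    subst h3 h4
    exact Or.inr ⟨B, rfl, h2⟩

theorem Att.branch {X F A B : RT α} (h : Att X F (join A B)) :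
    B = X ∨ ∃ A0 B0, F = join A0 B0 ∧ RT.sz B ≤ RT.sz B0 + RT.sz X := by
  rcases h.cases' with h1 | ⟨C, D, D', rfl, h1, h2⟩
  · rcases join_eq h1 with ⟨_, h⟩ | ⟨E, rfl, rfl⟩
    · exact Or.inl h
    · exact Or.inr ⟨E, B, rfl, by omega⟩
  · right
    rcases join_eq h1 with ⟨rfl, rfl⟩ | ⟨E, rfl, rfl⟩
    · exact ⟨_, _, rfl, h2.sz.le⟩
    · exact ⟨join E D, B, join_swap _ _ _, by omega⟩

theorem Att.branch' {X R A B : RT α} (h : Att X (join A B) R) :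
    ∃ A1 B1, R = join A1 B1 ∧ RT.sz B ≤ RT.sz B1 := by
  rcases h.inv with ⟨A', _, rfl⟩ | ⟨B', h', rfl⟩
  · exact ⟨_, _, rfl, le_rfl⟩
  · exact ⟨_, _, rfl, by have := Att.sz h'; omega⟩

theorem Att.reroot {X F F' Y : RT α} (h : Att X F Y) (hF : U F F') :
    ∃ Y', Att X F' Y' ∧ U Y Y' := by
  induction hF with
  | refl => exact ⟨Y, h, U.refl _⟩
  | tail _ hs ih =>
    obtain ⟨Y1, h1, h2⟩ := ih
    obtain ⟨A, B, rfl, rfl⟩ := hs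
    rcases h1.inv with ⟨A', h3, rfl⟩ | ⟨B', h3, rfl⟩
    · exact ⟨join B A', Att.sub _ h3, h2.trans (U.swap _ _)⟩
    · exact ⟨join B' A, Att.left _ h3, h2.trans (U.swap _ _)⟩

theorem Att.cut_aux {X B B' : RT α} (h : Att X B B') : ∀ K,
    ∃ Z, U Z (join B K) ∧ U (join B' K) (join Z X) := by
  induction h with
  | root F => exact fun K => ⟨join F K, U.refl _, U.of_eq (join_swap _ _ _)⟩
  | sub A h ih =>
    intro K
    obtain ⟨Z, h1, h2⟩ := ih (join A K)
    refine ⟨Z, h1.trans ((U.swap _ _).trans (U.of_eq (join_swap _ _ _))), ?_⟩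
    rw [join_swap]
    exact (U.swap _ _).trans h2

theorem Att.cut {X F Y : RT α} (h : Att X F Y) : ∃ Z, U Z F ∧ U Y (join Z X) := by
  cases h with
  | root => exact ⟨F, U.refl _, U.refl _⟩
  | sub A h =>
    obtain ⟨Z, h1, h2⟩ := h.cut_aux A
    exact ⟨Z, h1.trans (U.swap _ _), (U.swap _ _).trans h2⟩

theorem Att.map {β : Type} (g : α → β) {X F Y : RT α} (h : Att X F Y) :
    Att (map g X) (map g F) (map g Y) := by
  induction h with
  | root F => simp only [map_join]; exact Att.root _
  | sub A h ih => simp only [map_join]; exact Att.sub _ ih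
theorem Att.sh {X F Y : RT α} (h : Att X F Y) : Att (RT.sh X) (RT.sh F) (RT.sh Y) := h.map _

theorem Att.lift {X F : RT α} {y : RT Unit} (h : Att (RT.sh X) (RT.sh F) y) :
    ∃ Y, Att X F Y ∧ RT.sh Y = y := by
  generalize hf : RT.sh F = f at h
  induction h generalizing F with
  | root f => subst hf; exact ⟨join F X, Att.root _, by simp⟩
  | sub a h ih =>
    obtain ⟨A, B, rfl, rfl, rfl⟩ := sh_eq_join hf
    obtain ⟨B', h1, rfl⟩ := ih rfl
    exact ⟨join A B', Att.sub _ h1, by simp⟩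

end RT

namespace RT

/-! ### Paths and spiders -/

/-- Attach a new root above. -/
abbrev up (X : RT Unit) : RT Unit := join (one ()) X

theorem off1 {X Y C D : RT Unit} (hs : sz X + 2 = sz Y) (h : U (join X Y) (join C D))
    (hCD : sz C = sz D) :
    ∃ W, Y = up W ∧ ((up X = C ∧ W = D) ∨ (up X = D ∧ W = C)) := by
  have hsz := h.sz
  simp only [sz_join] at hsz
  have hc : Cen (join Y X) := by
    apply cen_join (by omega)
    intro E D' hY
    have h1 : sz Y = sz E + sz D' := by rw [hY, sz_join]
    have := sz_pos E
    omega
  have key : ∀ C D : RT Unit, sz C = sz X + 1 → sz C = sz D → join Y X = join C D →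
      Y = up D ∧ up X = C := by
    intro C D h1 h2 he
    rcases join_eq he with ⟨rfl, rfl⟩ | ⟨E, rfl, rfl⟩
    · omega
    · simp only [sz_join] at h1
      obtain ⟨c, rfl⟩ := sz_eq_one (R := E) (by omega)
      exact ⟨rfl, rfl⟩
  rcases half ((U.swap _ _).trans h) hc hCD with he | he
  · obtain ⟨h1, h2⟩ := key C D (by omega) hCD he
    exact ⟨D, h1, Or.inl ⟨h2, rfl⟩⟩
  · obtain ⟨h1, h2⟩ := key D C (by omega) hCD.symm he
    exact ⟨C, h1, Or.inr ⟨h2, rfl⟩⟩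

/-- Path with `n+1` vertices rooted at an end. -/
def pl : ℕ → RT Unit
  | 0 => one ()
  | n + 1 => join (one ()) (pl n)

/-- Path rooted at a vertex with legs of lengths `i` and `j`. -/
def pp (i : ℕ) : ℕ → RT Unit
  | 0 => pl i
  | j + 1 => join (pl i) (pl j)

theorem pl_zero : pl 0 = one () := rfl
theorem pl_succ (n : ℕ) : pl (n + 1) = up (pl n) := rfl
@[simp] theorem sz_pl (n : ℕ) : sz (pl n) = n + 1 := by
  induction n with
  | zero => rfl
  | succ n ih => rw [pl_succ, sz_join, ih, sz_one]; omega
@[simp] theorem sz_pp (i j : ℕ) : sz (pp i j) = i + j + 1 := by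
  cases j with
  | zero => simp [pp]
  | succ j => simp [pp]; omega
theorem pl_inj {m n : ℕ} (h : pl m = pl n) : m = n := by
  have := congrArg sz h
  simpa using this
theorem deg_pl_succ (n : ℕ) : deg (pl (n + 1)) = 1 := by simp [pl]
theorem deg_pl (n : ℕ) : deg (pl n) ≤ 1 := by
  cases n with
  | zero => simp [pl]
  | succ n => simp [pl]
theorem pp_comm (i j : ℕ) : pp i j = pp j i := by
  cases i with
  | zero => cases j with
    | zero => rfl
    | succ j => rfl
  | succ i => cases j with
    | zero => rfl
    | succ j => exact join_swap _ _ _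
theorem deg_pp (i j : ℕ) : deg (pp i j) ≤ 2 := by
  cases j with
  | zero => exact (deg_pl i).trans (by omega)
  | succ j => have := deg_pl i; simp only [pp, deg_join]; omega
theorem pp_step (i j : ℕ) : U (pp (i + 1) j) (pp i (j + 1)) := by
  rw [pp_comm]
  exact U.swap _ _
theorem U_pp_pl (j : ℕ) : ∀ i, U (pp i j) (pl (i + j)) := by
  induction j with
  | zero => exact fun i => U.refl _
  | succ j ih =>
    intro i
    have h := (pp_step i j).symm.trans (ih (i + 1))
    rwa [show i + 1 + j = i + (j + 1) by omega] at h
theorem U_pp {i j i' j' : ℕ} (h : i + j = i' + j') : U (pp i j) (pp i' j') := by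
  refine (U_pp_pl j i).trans ?_
  rw [h]
  exact (U_pp_pl j' i').symm

theorem pp_join {i j : ℕ} {A B : RT Unit} (h : pp i j = join A B) :
    ∃ x y, A = pl x ∧ B = pl y ∧ ((i = x ∧ j = y + 1) ∨ (j = x ∧ i = y + 1)) := by
  have pl_join : ∀ {i : ℕ} {A B : RT Unit}, pl i = join A B →
      ∃ y, A = one () ∧ B = pl y ∧ i = y + 1 := by
    intro i A B h
    cases i with
    | zero => exact absurd h.symm (join_ne_one _ _ _)
    | succ i =>
      obtain ⟨h1, h2⟩ := join_eq_up h.symm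
      exact ⟨i, h1, h2, rfl⟩
  cases j with
  | zero =>
    obtain ⟨y, h1, h2, h3⟩ := pl_join (i := i) h
    exact ⟨0, y, h1, h2, Or.inr ⟨rfl, h3⟩⟩
  | succ j =>
    rcases join_eq h with ⟨rfl, rfl⟩ | ⟨E, h1, rfl⟩
    · exact ⟨i, j, rfl, rfl, Or.inl ⟨rfl, rfl⟩⟩
    · obtain ⟨y, rfl, h2, h3⟩ := pl_join h1
      exact ⟨j + 1, y, rfl, h2, Or.inr ⟨rfl, h3⟩⟩

theorem pl_join {i : ℕ} {A B : RT Unit} (h : pl i = join A B) :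
      ∃ y, A = one () ∧ B = pl y ∧ i = y + 1 := by
  obtain ⟨x, y, rfl, rfl, h1⟩ := pp_join (i := i) (j := 0) h
  rcases h1 with ⟨h1, h2⟩ | ⟨h1, h2⟩
  · omega
  · subst h1
    exact ⟨y, rfl, rfl, h2⟩

theorem U.pp_inv {i j : ℕ} {S : RT Unit} (h : U (pp i j) S) :
    ∃ i' j', i' + j' = i + j ∧ S = pp i' j' := by
  induction h with
  | refl => exact ⟨i, j, rfl, rfl⟩
  | tail _ hs ih =>
    obtain ⟨i', j', h1, rfl⟩ := ih
    obtain ⟨A, B, h2, rfl⟩ := hs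
    obtain ⟨x, y, rfl, rfl, h3⟩ := pp_join h2
    exact ⟨y, x + 1, by omega, rfl⟩

theorem pp_inj {i j i' j' : ℕ} (h : pp i j = pp i' j') : (i = i' ∧ j = j') ∨ (i = j' ∧ j = i') := by
  have key : ∀ i' y, pp i j = pp i' (y + 1) → (i = i' ∧ j = y + 1) ∨ (i = y + 1 ∧ j = i') := by
    intro i' y h
    obtain ⟨x, y1, h1, h2, h3⟩ := pp_join h
    have := pl_inj h1
    have := pl_inj h2
    omega
  cases j' with
  | succ y => exact key _ _ h
  | zero =>
    cases i' with
    | succ y =>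
      rw [pp_comm (y + 1)] at h
      have := key _ _ h
      omega
    | zero =>
      have := congrArg sz h
      simp at this
      omega

theorem Att.pl_inv {X F : RT Unit} : ∀ {m : ℕ}, Att X F (pl m) → ∃ n, F = pl n := by
  intro m
  induction m generalizing F with
  | zero => exact fun h => h.ne_one.elim
  | succ m ih =>
    intro h
    rcases h.to_up with ⟨rfl, _⟩ | ⟨F1, rfl, h1⟩
    · exact ⟨0, rfl⟩
    · obtain ⟨n, rfl⟩ := ih h1
      exact ⟨n + 1, rfl⟩

theorem Att.pl_inv_one {F : RT Unit} {m : ℕ} (h : Att (one ()) F (pl m)) :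
    ∃ n, m = n + 1 ∧ F = pl n := by
  obtain ⟨n, rfl⟩ := h.pl_inv
  refine ⟨n, ?_, rfl⟩
  have := Att.sz h
  simp at this
  omega

theorem Att.pp_inv {F : RT Unit} {i j : ℕ} (h : Att (one ()) F (pp i j)) :
    (∃ x, i = x + 1 ∧ F = pp x j) ∨ (∃ y, j = y + 1 ∧ F = pp i y) := by
  rcases h.cases' with h1 | ⟨A, B, B', rfl, h1, h2⟩
  · obtain ⟨x, y, rfl, h3, h4⟩ := pp_join h1
    have : y = 0 := (pl_inj (m := 0) h3).symm
    subst this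
    rcases h4 with ⟨rfl, rfl⟩ | ⟨rfl, rfl⟩
    · exact Or.inr ⟨0, rfl, rfl⟩
    · exact Or.inl ⟨0, rfl, by rw [pp_comm]; rfl⟩
  · obtain ⟨x, y, rfl, rfl, h4⟩ := pp_join h1
    obtain ⟨y', rfl, rfl⟩ := h2.pl_inv_one
    rcases h4 with ⟨rfl, rfl⟩ | ⟨rfl, rfl⟩
    · exact Or.inr ⟨y' + 1, rfl, rfl⟩
    · exact Or.inl ⟨y' + 1, rfl, by rw [pp_comm]; rfl⟩

/-- Spider with legs of `x+1`, `y+1`, `z+1` edges, rooted at its centre. -/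
def s3 (x y z : ℕ) : RT Unit := join (join (join (one ()) (pl x)) (pl y)) (pl z)

theorem s3_swap1 (x y z : ℕ) : s3 x y z = s3 y x z := by
  unfold s3; rw [join_swap (one ())]
theorem s3_swap2 (x y z : ℕ) : s3 x y z = s3 x z y := join_swap _ _ _

theorem Desc.deg_le {n : ℕ} : ∀ {K S : RT Unit}, Desc K (pl n) S → deg S ≤ 2 := by
  induction n with
  | zero =>
    intro K S h
    generalize hB : pl 0 = B at h
    cases h with
    | here => subst hB; simp [pl]
    | there => exact absurd hB.symm (join_ne_one _ _ _)
  | succ n ih =>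
    intro K S h
    generalize hB : pl (n + 1) = B at h
    cases h with
    | here => subst hB; simp [pl]
    | there _ B1 B2 h =>
      obtain ⟨_, rfl⟩ := join_eq_up hB.symm
      exact ih h

theorem s3uniq {x y z : ℕ} {S : RT Unit} (h : U (s3 x y z) S) (hd : 3 ≤ deg S) : S = s3 x y z := by
  rcases h.desc with h | ⟨A, B, h1, h2⟩
  · exact h.symm
  · exfalso
    have hB : B ∈ br (s3 x y z) := by rw [h1]; simp
    have : ∃ n, B = pl n := by
      simp only [s3, br_join, br_one, Multiset.mem_cons, Multiset.notMem_zero, or_false] at hB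
      rcases hB with h | h | h
      · exact ⟨_, h⟩
      · exact ⟨_, h⟩
      · exact ⟨_, h⟩
    obtain ⟨n, rfl⟩ := this
    have := h2.deg_le
    omega

theorem pp_cases (i j : ℕ) : (∃ n, pp i j = pl n ∧ n = i + j) ∨
    ∃ x y, i = x + 1 ∧ j = y + 1 ∧ pp i j = join (up (pl x)) (pl y) := by
  cases i with
  | zero => exact Or.inl ⟨j, by rw [pp_comm]; rfl, by omega⟩
  | succ x => cases j with
    | zero => exact Or.inl ⟨x + 1, rfl, rfl⟩
    | succ y => exact Or.inr ⟨x, y, rfl, rfl, rfl⟩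

theorem upuniq {i j i' j' : ℕ} (h : U (up (pp i j)) (up (pp i' j'))) : pp i j = pp i' j' := by
  have hsz := h.sz
  simp at hsz
  have key : ∀ n x y, ¬ U (up (pl n)) (up (join (up (pl x)) (pl y))) := by
    intro n x y h
    obtain ⟨a, b, _, h1⟩ := U.pp_inv (i := n + 1) (j := 0) (h.trans (U.swap _ _))
    have := deg_pp a b
    rw [← h1] at this
    simp at this
  rcases pp_cases i j with ⟨n, h1, hn⟩ | ⟨x, y, rfl, rfl, h1⟩ <;>
    rcases pp_cases i' j' with ⟨n', h1', hn'⟩ | ⟨x', y', rfl, rfl, h1'⟩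
  · rw [h1, h1', hn, hn']; congr 1
  · rw [h1, h1'] at h; exact (key _ _ _ h).elim
  · rw [h1, h1'] at h; exact (key _ _ _ h.symm).elim
  · rw [h1, h1'] at h ⊢
    have h2 : U (s3 x y 0) (s3 x' y' 0) := (U.swap _ _).trans (h.trans (U.swap _ _))
    have h3 := s3uniq h2 (by simp [s3])
    exact (join_right_cancel h3).symm

theorem path2 : ∀ n, ∀ f g : RT Unit, sz f ≤ n → Att (one ()) f (up g) → Att (one ()) g (up f) →
    ∃ m, f = pl m ∧ g = pl m := by
  intro n
  induction n with
  | zero => intro f g h; have := sz_pos f; omega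
  | succ n ih =>
    intro f g h h1 h2
    rcases h1.to_up with ⟨rfl, rfl⟩ | ⟨f1, rfl, h3⟩
    · exact ⟨0, rfl, rfl⟩
    · rcases h2.to_up with ⟨_, h5⟩ | ⟨g1, rfl, h4⟩
      · exact absurd h5 (join_ne_one _ _ _)
      · obtain ⟨m, rfl, rfl⟩ := ih f1 g1 (by simp at h; omega) h3 h4
        exact ⟨m + 1, rfl, rfl⟩

theorem path3 : ∀ n, ∀ g : RT Unit, sz g ≤ n → Att (pl 1) g (up (up g)) → ∃ m, g = pl m := by
  intro n
  induction n with
  | zero => intro f h; have := sz_pos f; omega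
  | succ n ih =>
    intro g h h1
    rcases h1.to_up with ⟨rfl, _⟩ | ⟨f1, rfl, h3⟩
    · exact ⟨0, rfl⟩
    · obtain ⟨m, rfl⟩ := ih f1 (by simp at h; omega) h3
      exact ⟨m + 1, rfl⟩

end RT

namespace RT

variable {α : Type}

theorem sz_mem_br {R B : RT α} (h : B ∈ br R) : sz B < sz R := by
  obtain ⟨A, rfl⟩ := exists_join_of_mem R B h
  have := sz_pos A
  simp; omega

theorem cen_of_mem {R : RT α} (h : ∀ B ∈ br R, 2 * sz B ≤ sz R) : Cen R := by
  rintro A B rfl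
  have := h B (by simp)
  simp at this; omega

theorem Cen.scen {R : RT α} (h : Cen R) (hodd : sz R % 2 = 1) : SCen R := by
  rintro A B rfl
  have := h A B rfl
  simp at hodd; omega

/-- Rooted irreplaceability of an end vertex of colour `c`. -/
def RIrr (c : α) (F R : RT α) : Prop :=
  Att (one c) F R ∧ ∀ Y, Att (one c) F Y → sh Y = sh R → Y = R

theorem RIrr.sz {c : α} {F R : RT α} (h : RIrr c F R) : RT.sz R = RT.sz F + 1 := by
  simpa using h.1.sz

theorem exists_rirr : ∀ n, ∀ R : RT α, sz R ≤ n → 2 ≤ sz R → ∃ c F, RIrr c F R := by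
  intro n
  induction n with
  | zero => intro R h; have := sz_pos R; omega
  | succ n ih =>
    intro R hn h2
    have hex : ∃ m, ∃ A B, R = join A B ∧ sz B = m := by
      rcases one_or_join R with ⟨c, rfl⟩ | ⟨A, B, h⟩
      · simp at h2
      · exact ⟨_, A, B, h, rfl⟩
    classical
    obtain ⟨A, B, rfl, hm⟩ := Nat.find_spec hex
    have hmin : ∀ A' B', join A B = join A' B' → sz B ≤ sz B' := by
      intro A' B' h
      rw [hm]
      exact Nat.find_min' hex ⟨A', B', h, rfl⟩
    clear hm
    by_cases h1 : sz B = 1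
    · obtain ⟨c, rfl⟩ := sz_eq_one h1
      refine ⟨c, A, Att.root _, ?_⟩
      intro Y hY hsh
      rcases hY.cases' with h | ⟨C, D, D', rfl, rfl, _⟩
      · exact h
      · have := congrArg deg hsh
        simp at this
    · have := sz_pos B
      have := sz_pos A
      simp only [sz_join] at hn
      obtain ⟨c, F, hF⟩ := ih B (by omega) (by omega)
      refine ⟨c, join A F, Att.sub _ hF.1, ?_⟩
      intro Y hY hsh
      have hsF := hF.sz
      rcases hY.inv with ⟨A', h3, rfl⟩ | ⟨F', h3, rfl⟩
      · exfalso
        simp only [sh_join] at hsh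
        rcases join_eq hsh with ⟨_, h4⟩ | ⟨E, h4, h5⟩
        · have := congrArg RT.sz h4
          simp at this; omega
        · obtain ⟨E', F', rfl, _, h6⟩ := sh_eq_join h5
          have h7 := hmin _ _ (join_swap _ _ _)
          have := congrArg RT.sz h6
          simp at this; omega
      · simp only [sh_join] at hsh
        rw [hF.2 F' h3 (join_left_cancel hsh)]

/-- Some end vertex (together with its colour) is irreplaceable. -/
def Irr (G : RT α) : Prop := ∃ c F G', U G' G ∧ Att (one c) F G' ∧
  ∀ Y, Att (one c) F Y → U (sh Y) (sh G') → Y = G'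

theorem Irr.of_U {G H : RT α} (h : U G H) (hG : Irr G) : Irr H := by
  obtain ⟨c, F, G', h1, h2⟩ := hG
  exact ⟨c, F, G', h1.trans h, h2⟩

def Bad (a b : RT Unit) : Prop := (∃ m, a = pl m ∧ b = pl m) ∨ Att (one ()) b (up a)

theorem Bad.both {a b : RT Unit} (h : Bad a b) (h' : Bad b a) : ∃ m, a = pl m ∧ b = pl m := by
  rcases h with h | h
  · exact h
  rcases h' with ⟨m, h1, h2⟩ | h'
  · exact ⟨m, h2, h1⟩
  exact path2 _ a b le_rfl h' h

theorem att_self {a : RT Unit} (h : Att (one ()) a (up a)) : ∃ m, a = pl m := by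
  obtain ⟨m, h, _⟩ := path2 _ a a le_rfl h h
  exact ⟨m, h⟩

theorem irr_case1 {A B : RT α} (hs : sz A = sz B) (h2 : 2 ≤ sz A) :
    Irr (join A B) ∨ Bad (sh A) (sh B) := by
  obtain ⟨c, F, hF⟩ := exists_rirr _ A le_rfl h2
  by_cases hb : Bad (sh A) (sh B)
  · exact Or.inr hb
  left
  refine ⟨c, join F B, join A B, U.refl _, Att.left _ hF.1, ?_⟩
  intro Y hY hU
  have hsF := hF.sz
  rcases hY.inv with ⟨F', h3, rfl⟩ | ⟨B', h3, rfl⟩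
  · have hs' : sz F' = sz B := by have := Att.sz h3; simp at this; omega
    simp only [sh_join] at hU
    have : sh F' = sh A := by
      rcases bic hU (by simpa using hs') (by simpa using hs) with ⟨h, _⟩ | ⟨h, h'⟩
      · exact h
      · rw [h, h']
    rw [hF.2 F' h3 this]
  · exfalso
    apply hb
    have hs' : sz F + 2 = sz B' := by have := Att.sz h3; simp at this; omega
    simp only [sh_join] at hU
    have h4 := h3.sh
    have h5 := hF.1.sh
    simp only [sh_one] at h4 h5
    obtain ⟨W, h6, ⟨h7, h8⟩ | ⟨h7, h8⟩⟩ := off1 (by simpa using hs') hU (by simpa using hs)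
    · left
      rw [h6, h8] at h4
      rw [← h7] at h5
      obtain ⟨m, hm⟩ := att_self h4
      obtain ⟨m', hm'⟩ := att_self h5
      have e1 := congrArg sz hm
      have e2 := congrArg sz hm'
      simp at e1 e2
      refine ⟨m, ?_, hm⟩
      rw [← h7, hm', ← pl_succ]
      congr 1
      omega
    · right
      rw [h6, h8] at h4
      exact h4

theorem irr_case2a {G : RT α} (h2 : 2 ≤ sz G) (h : ∀ A B, G = join A B → sz B + 2 ≤ sz A) :
    Irr G := by
  obtain ⟨c, F, hF⟩ := exists_rirr _ G le_rfl h2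
  have hsF := hF.sz
  refine ⟨c, F, G, U.refl _, hF.1, ?_⟩
  intro Y hY hU
  have hsY := Att.sz hY
  simp only [sz_one] at hsY
  have hS : SCen G := by
    intro A B e
    have := h A B e
    omega
  have hC : Cen Y := by
    rintro A B rfl
    simp only [sz_join] at hsY
    rcases hY.branch with rfl | ⟨A0, B0, rfl, h3⟩
    · have := sz_pos A
      simp; omega
    · obtain ⟨A1, B1, rfl, h4⟩ := hF.1.branch'
      have := h A1 B1 rfl
      simp at h3 hsF hsY
      omega
  exact hF.2 Y hY (uni hU hC.sh hS.sh)

theorem irr_gamma {A R : RT α} (hG : SCen (join A R)) (hs : sz A = sz R + 1)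
    (h : ∀ E D, A = join E D → sz D + 2 ≤ sz R) : Irr (join A R) := by
  obtain ⟨E0, D0, hA0⟩ : ∃ E D, A = join E D := by
    rcases one_or_join A with ⟨c, rfl⟩ | h
    · have := sz_pos R; simp at hs; omega
    · exact h
  have h3 := h _ _ hA0
  have h4 := sz_pos D0
  obtain ⟨c, F, hF⟩ := exists_rirr _ R le_rfl (by omega)
  have hsF := hF.sz
  refine ⟨c, join A F, join A R, U.refl _, Att.sub _ hF.1, ?_⟩
  intro Y hY hU
  rcases hY.inv with ⟨A', h5, rfl⟩ | ⟨F', h5, rfl⟩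
  · exfalso
    have hs' := Att.sz h5
    simp only [sz_one] at hs'
    have hb : ∀ E D, A' = join E D → sz D + 1 ≤ sz R := by
      rintro E D rfl
      rcases h5.branch with rfl | ⟨A1, B1, h6, h7⟩
      · simp; omega
      · have := h _ _ h6
        simp at h7; omega
    have hC : Cen (join A' F) := by
      apply cen_join (by omega)
      intro E D e
      have h8 : sz A' = sz E + sz D := by rw [e, sz_join]
      have := hb E D e
      omega
    have := uni hU hC.sh hG.sh
    simp only [sh_join] at this
    rcases join_eq this with ⟨_, h7⟩ | ⟨E, h7, _⟩
    · have := congrArg sz h7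
      simp at this; omega
    · obtain ⟨E', R', h8, _, h9⟩ := sh_eq_join h7
      have := hb _ _ h8
      have := congrArg sz h9
      simp at this; omega
  · have hs' := Att.sz h5
    simp only [sz_one] at hs'
    have hC : Cen (join A F') := by
      apply cen_join (by omega)
      intro E D e
      have := h _ _ e
      omega
    have := uni hU hC.sh hG.sh
    simp only [sh_join] at this
    rw [hF.2 F' h5 (join_left_cancel this)]

theorem irr_alpha {c0 : α} {S R : RT α} (hs : sz S = sz R) (h2 : 2 ≤ sz R)
    (hG : SCen (join (join (one c0) S) R)) :
    Irr (join (join (one c0) S) R) ∨ Bad (sh R) (sh S) := by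
  obtain ⟨c, F, hF⟩ := exists_rirr _ R le_rfl h2
  have hsF := hF.sz
  by_cases hb : Bad (sh R) (sh S)
  · exact Or.inr hb
  left
  refine ⟨c, join (join (one c0) S) F, _, U.refl _, Att.sub _ hF.1, ?_⟩
  intro Y hY hU
  rcases hY.inv with ⟨A', h5, rfl⟩ | ⟨F', h5, rfl⟩
  · exfalso
    rcases h5.inv with ⟨C', h6, rfl⟩ | ⟨S', h6, rfl⟩
    · have := h6.inv_one
      subst this
      have hC : Cen (join (join (join (one c0) (one c)) S) F) := by
        apply cen_of_mem
        simp
        omega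
      have := congrArg deg (uni hU hC.sh hG.sh)
      simp at this
    · apply hb
      have hs' := Att.sz h6
      simp only [sz_one] at hs'
      have hC : Cen (join S' (join (one c0) F)) := by
        apply cen_of_mem
        simp only [br_join, Multiset.mem_cons, sz_join, sz_one]
        rintro B (rfl | hB)
        · simp; omega
        · have := sz_mem_br hB
          omega
      have hU' : U (join S' (join (one c0) F)) (join (join (one c0) S') F) :=
        (U.swap _ _).trans (U.of_eq (join_swap _ _ _))
      have he := uni (hU'.sh.trans hU) hC.sh hG.sh
      simp only [sh_join, sh_one] at he
      have h7 := h6.sh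
      have h8 := hF.1.sh
      simp only [sh_one] at h7 h8
      rcases join_eq he with ⟨e1, e2⟩ | ⟨E, e1, e2⟩
      · rw [e1] at h7
        rw [← e2] at h8
        obtain ⟨m, hm⟩ := att_self h7
        obtain ⟨m', hm'⟩ := att_self h8
        left
        have e3 := congrArg sz hm
        have e4 := congrArg sz hm'
        simp at e3 e4
        refine ⟨m, ?_, hm⟩
        rw [← e2, hm']
        change pl (m' + 1) = pl m
        congr 1
        omega
      · obtain ⟨rfl, _⟩ := join_eq_up e2.symm
        rw [e1] at h7
        exact Or.inr h7
  · have hs' := Att.sz h5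
    simp only [sz_one] at hs'
    have hC : Cen (join (join (one c0) S) F') := by
      apply cen_of_mem
      simp
      omega
    have := uni hU hC.sh hG.sh
    simp only [sh_join] at this
    rw [hF.2 F' h5 (join_left_cancel this)]

theorem irr_beta {c0 d : α} {S R : RT α} (hs : sz S + 1 = sz R) (h3 : 3 ≤ sz R)
    (hG : SCen (join (join (join (one c0) S) (one d)) R))
    (h123 : ¬ U (sh (join (join (join (one c0) S) (one d)) R)) (s3 0 1 2)) :
    Irr (join (join (join (one c0) S) (one d)) R) := by
  have hcen : ∀ X K : RT α, sz X = sz R + 1 → sz K = sz R → Cen (join X K) := by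
    intro X K h1 h2
    apply cen_of_mem
    simp only [br_join, Multiset.mem_cons, sz_join]
    rintro B (rfl | hB)
    · omega
    · have := sz_mem_br hB
      omega
  by_cases hun : ∃ e Q, R = join (one e) Q
  · obtain ⟨e, Q, rfl⟩ := hun
    simp only [sz_join, sz_one] at hs h3
    by_cases h4 : sz S = 2
    · exfalso
      apply h123
      have two : ∀ S : RT α, sz S = 2 → sh S = pl 1 := by
        intro S h
        rcases one_or_join S with ⟨c, rfl⟩ | ⟨A, B, rfl⟩
        · simp at h
        · have := sz_pos A
          have := sz_pos B
          simp at h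
          obtain ⟨x, rfl⟩ := sz_eq_one (R := A) (by omega)
          obtain ⟨y, rfl⟩ := sz_eq_one (R := B) (by omega)
          rfl
      apply U.of_eq
      simp only [sh_join, sh_one]
      rw [two S h4, two Q (by omega), s3_swap1]
      rfl
    · obtain ⟨c, F, hF⟩ := exists_rirr _ S le_rfl (by omega)
      have hsF := hF.sz
      refine ⟨c, join (join (join (one c0) F) (one d)) (join (one e) Q), _, U.refl _,
        Att.left _ (Att.left _ (Att.sub _ hF.1)), ?_⟩
      intro Y hY hU
      rcases hY.inv with ⟨A', h5, rfl⟩ | ⟨R', h5, rfl⟩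
      · rcases h5.inv with ⟨K, h6, rfl⟩ | ⟨w', h6, rfl⟩
        · rcases h6.inv with ⟨C', h7, rfl⟩ | ⟨F', h7, rfl⟩
          · exfalso
            have := h7.inv_one
            subst this
            have hC : Cen (join (join (join (join (one c0) (one c)) F) (one d)) (join (one e) Q)) := by
              apply cen_of_mem
              simp
              omega
            have := congrArg deg (uni hU hC.sh hG.sh)
            simp at this
          · have hs' := Att.sz h7
            simp only [sz_one] at hs'
            have hC : Cen (join (join (join (one c0) F') (one d)) (join (one e) Q)) := by
              apply cen_of_mem
              simp
              omega
            have := uni hU hC.sh hG.sh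
            simp only [sh_join] at this
            rw [hF.2 F' h7 (join_left_cancel (join_right_cancel (join_right_cancel this)))]
        · exfalso
          have := h6.inv_one
          subst this
          have hC : Cen (join (join (join (one c0) F) (join (one d) (one c))) (join (one e) Q)) := by
            apply cen_of_mem
            simp
            omega
          have := uni hU hC.sh hG.sh
          simp only [sh_join] at this
          rcases join_eq (join_right_cancel this) with ⟨_, h8⟩ | ⟨E, h8, _⟩
          · exact absurd h8 (join_ne_one _ _ _)
          · obtain ⟨_, h9⟩ := join_eq_up h8.symm
            have := congrArg sz h9
            simp at this; omega
      · exfalso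
        have hs' := Att.sz h5
        simp only [sz_join, sz_one] at hs'
        have hC := hcen R' (join (join (one c0) F) (one d)) (by simp; omega) (by simp; omega)
        have he := uni ((U.swap _ _).sh.trans hU) hC.sh hG.sh
        simp only [sh_join] at he
        rcases join_eq he with ⟨_, h8⟩ | ⟨E, _, h8⟩
        · have := congrArg deg h8
          simp at this
        · rcases join_eq h8 with ⟨_, h9⟩ | ⟨E', h9, _⟩
          · have := congrArg sz h9
            simp at this
          · obtain ⟨_, h9⟩ := join_eq_up h9.symm
            have := congrArg sz h9
            simp at this; omega
  · refine ⟨d, join (join (one c0) S) R, _, U.refl _, Att.left _ (Att.root _), ?_⟩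
    intro Y hY hU
    rcases hY.inv with ⟨K, h5, rfl⟩ | ⟨R', h5, rfl⟩
    · rcases h5.inv with ⟨C', h6, rfl⟩ | ⟨S', h6, rfl⟩
      · have := h6.inv_one
        subst this
        rw [join_swap (one c0)]
      · exfalso
        have hs' := Att.sz h6
        simp only [sz_one] at hs'
        have hC : Cen (join (join (one c0) S') R) := by
          apply cen_of_mem
          simp
          omega
        have := congrArg deg (uni hU hC.sh hG.sh)
        simp at this
    · exfalso
      have hs' := Att.sz h5
      simp only [sz_one] at hs'
      have hC := hcen R' (join (one c0) S) (by omega) (by simp; omega)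
      have he := uni ((U.swap _ _).sh.trans hU) hC.sh hG.sh
      simp only [sh_join] at he
      rcases join_eq he with ⟨_, h8⟩ | ⟨E, _, h8⟩
      · obtain ⟨A1, B1, rfl, h9, _⟩ := sh_eq_join h8.symm
        obtain ⟨e, rfl⟩ := sh_eq_one h9
        exact hun ⟨e, B1, rfl⟩
      · rcases join_eq h8 with ⟨_, h9⟩ | ⟨E', h9, _⟩
        · exact absurd h9.symm (join_ne_one _ _ _)
        · have h10 := congrArg sz h9
          have := sz_pos E'
          simp at h10; omega

theorem exists_irr (G : RT α) (hpp : ∀ i j, sh G ≠ pp i j) (h112 : ¬ U (sh G) (s3 0 0 1))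
    (h123 : ¬ U (sh G) (s3 0 1 2)) : Irr G := by
  obtain ⟨G1, hU, hcen⟩ := exists_cen G
  apply Irr.of_U hU.symm
  replace hpp : ∀ i j, sh G1 ≠ pp i j := by
    intro i j h
    have h1 := hU.symm.sh
    rw [h] at h1
    obtain ⟨i', j', _, h2⟩ := h1.pp_inv
    exact hpp _ _ h2
  replace h112 : ¬ U (sh G1) (s3 0 0 1) := fun h => h112 (hU.sh.trans h)
  replace h123 : ¬ U (sh G1) (s3 0 1 2) := fun h => h123 (hU.sh.trans h)
  clear hU
  have h2 : 2 ≤ sz G1 := by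
    have := sz_pos G1
    by_contra hc
    obtain ⟨c, rfl⟩ := sz_eq_one (R := G1) (by omega)
    exact hpp 0 0 rfl
  by_cases c1 : ∃ A B, G1 = join A B ∧ sz A = sz B
  · obtain ⟨A, B, rfl, hs⟩ := c1
    have h2A : 2 ≤ sz A := by
      have := sz_pos A
      by_contra hc
      obtain ⟨c, rfl⟩ := sz_eq_one (R := A) (by omega)
      obtain ⟨d, rfl⟩ := sz_eq_one (R := B) (by simp at hs; omega)
      exact hpp 0 1 rfl
    rcases irr_case1 hs h2A with h | h
    · exact h
    rcases irr_case1 hs.symm (by omega) with h' | h'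
    · exact h'.of_U (U.swap _ _)
    obtain ⟨m, h3, h4⟩ := h.both h'
    exact absurd (by rw [sh_join, h3, h4]; rfl) (hpp m (m + 1))
  by_cases c2 : ∃ A B, G1 = join A B ∧ sz A = sz B + 1
  · obtain ⟨A, R, rfl, hs⟩ := c2
    have hS : SCen (join A R) := hcen.scen (by simp; omega)
    by_cases ca : ∃ E D, A = join E D ∧ sz D = sz R
    · obtain ⟨E, S, rfl, hsS⟩ := ca
      simp only [sz_join] at hs
      obtain ⟨c, rfl⟩ := sz_eq_one (R := E) (by omega)
      have h2R : 2 ≤ sz R := by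
        have := sz_pos R
        by_contra hc
        obtain ⟨c, rfl⟩ := sz_eq_one (R := R) (by omega)
        obtain ⟨d, rfl⟩ := sz_eq_one (R := S) (by simp at hsS; omega)
        exact hpp 1 1 rfl
      rcases irr_alpha hsS h2R hS with h | h
      · exact h
      rw [join_swap] at hS ⊢
      rcases irr_alpha hsS.symm (by omega) hS with h' | h'
      · exact h'
      obtain ⟨m, h3, h4⟩ := h.both h'
      exact absurd (by rw [sh_join, sh_join, h3, h4]; rfl) (hpp (m + 1) (m + 1))
    by_cases cb : ∃ E D, A = join E D ∧ sz D + 1 = sz R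
    · obtain ⟨E, S, rfl, hsS⟩ := cb
      simp only [sz_join] at hs
      rcases one_or_join E with ⟨c, rfl⟩ | ⟨C, w, rfl⟩
      · simp at hs; omega
      have := sz_pos C
      have := sz_pos w
      simp only [sz_join] at hs
      obtain ⟨c, rfl⟩ := sz_eq_one (R := C) (by omega)
      obtain ⟨d, rfl⟩ := sz_eq_one (R := w) (by simp at hs; omega)
      rw [join_swap (one c)] at hS hpp h112 h123 ⊢
      have h3R : 3 ≤ sz R := by
        have := sz_pos S
        by_contra hc
        apply h112
        obtain ⟨x, rfl⟩ := sz_eq_one (R := S) (by omega)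
        simp only [sz_one] at hsS
        rcases one_or_join R with ⟨c, rfl⟩ | ⟨P, Q, rfl⟩
        · simp at hsS
        · have := sz_pos P
          have := sz_pos Q
          simp at hsS
          obtain ⟨y, rfl⟩ := sz_eq_one (R := P) (by omega)
          obtain ⟨z, rfl⟩ := sz_eq_one (R := Q) (by simp at hsS; omega)
          exact U.refl _
      exact irr_beta hsS h3R hS h123
    · apply irr_gamma hS hs
      rintro E D rfl
      have h5 := hcen (join E R) D (join_swap _ _ _)
      simp only [sz_join] at h5 hs
      have h6 : sz D ≠ sz R := fun h => ca ⟨_, _, rfl, h⟩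
      have h7 : sz D + 1 ≠ sz R := fun h => cb ⟨_, _, rfl, h⟩
      omega
  · apply irr_case2a h2
    intro A B h
    have h3 := hcen A B h
    have h4 : sz A ≠ sz B := fun h' => c1 ⟨_, _, h, h'⟩
    have h5 : sz A ≠ sz B + 1 := fun h' => c2 ⟨_, _, h, h'⟩
    omega

end RT

namespace RT

/-! ### Marking the root -/

def bw (b : Bool) : ℕ := if b then 1 else 0

theorem col_le_mu (T : RT Bool) : bw (col T) ≤ mu bw T := by
  induction T using ind with
  | h1 c => simp
  | h2 A B ha hb => simp; omega

theorem exists_unmarked (G : RT Unit) : ∃ M : RT Bool, sh M = G ∧ mu bw M = 0 := by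
  induction G using ind with
  | h1 c => exact ⟨one false, rfl, rfl⟩
  | h2 A B ha hb =>
    obtain ⟨M, rfl, h1⟩ := ha
    obtain ⟨N, rfl, h2⟩ := hb
    exact ⟨join M N, by simp, by simp [h1, h2]⟩

theorem exists_mark (G : RT Unit) : ∃ M : RT Bool, sh M = G ∧ mu bw M = 1 ∧ col M = true := by
  induction G using ind with
  | h1 c => exact ⟨one true, rfl, rfl, rfl⟩
  | h2 A B ha hb =>
    obtain ⟨M, rfl, h1, h3⟩ := ha
    obtain ⟨N, rfl, h2⟩ := exists_unmarked B
    exact ⟨join M N, by simp, by simp [h1, h2], by simp [h3]⟩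

theorem Att.col {α : Type} {X F Y : RT α} (h : Att X F Y) : RT.col Y = RT.col F := by
  cases h with
  | root => simp
  | sub => simp

theorem exists_root_true (R : RT Bool) (h : 1 ≤ mu bw R) : ∃ R', U R R' ∧ col R' = true := by
  induction R using ind with
  | h1 c =>
    cases c with
    | true => exact ⟨_, U.refl _, rfl⟩
    | false => simp [bw] at h
  | h2 A B ha hb =>
    have key : ∀ A B : RT Bool, (∃ A', U A A' ∧ col A' = true) →
        ∃ R', U (join A B) R' ∧ col R' = true := by
      rintro A B ⟨A', h1, h2⟩
      obtain ⟨Y, h3, h4⟩ := (Att.root (X := B) A).reroot h1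
      exact ⟨Y, h4, by rw [h3.col, h2]⟩
    simp only [mu_join] at h
    rcases Nat.eq_zero_or_pos (mu bw A) with h0 | h0
    · obtain ⟨R', h1, h2⟩ := key B A (hb (by omega))
      exact ⟨R', (U.swap _ _).trans h1, h2⟩
    · exact key A B (ha h0)

def Alt1 (G : RT Unit) : Prop := ∃ f, G = up f ∧ ∀ g, U g f → U (up g) G → g = f
def Alt2 (G : RT Unit) : Prop := ∃ f, Att (one ()) f G ∧ ∀ Y, Att (one ()) f Y → U Y G → Y = G
/-- Not a pseudopath. -/
def NPs (G : RT Unit) : Prop :=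
  (∀ i j, G ≠ pp i j) ∧ ¬ U G (s3 0 0 1) ∧ ¬ U G (s3 0 1 2)

theorem key_alt {G : RT Unit} (h : NPs G) : Alt1 G ∨ Alt2 G := by
  obtain ⟨M, rfl, hM, hMc⟩ := exists_mark G
  have hMc' : bw (col M) = 1 := by rw [hMc]; rfl
  obtain ⟨c, F, G', hU, hA, hu⟩ := exists_irr M h.1 h.2.1 h.2.2
  cases c with
  | true =>
    left
    obtain ⟨Z, hZ, hGZ⟩ := hA.cut
    have e : M = join (one true) Z :=
      mark_uniq bw (hU.symm.trans (hGZ.trans (U.swap _ _))) hM hMc' (by simp [bw])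
    refine ⟨sh Z, by rw [e, sh_join, sh_one], ?_⟩
    intro g hg hgM
    obtain ⟨Z1, hZ1, rfl⟩ := hg.symm.lift
    obtain ⟨Y, hY, hUY⟩ := (Att.root (X := one true) Z1).reroot (hZ1.symm.trans hZ)
    have hY1 : U (sh (join Z1 (one true))) (sh G') :=
      ((U.swap _ _).sh.trans ((U.of_eq (by rw [sh_join, sh_one])).trans hgM)).trans hU.sh.symm
    have := hu Y hY (hUY.sh.symm.trans hY1)
    subst this
    have e2 : M = join (one true) Z1 :=
      mark_uniq bw (hU.symm.trans (hUY.symm.trans (U.swap _ _))) hM hMc' (by simp [bw])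
    rw [e] at e2
    rw [join_left_cancel e2]
  | false =>
    right
    have hmu : mu bw F = 1 := by
      obtain ⟨Z, hZ, hGZ⟩ := hA.cut
      have h1 := (hU.symm.trans hGZ).mu (w := bw)
      have h2 := hZ.mu (w := bw)
      simp [bw] at h1
      unfold bw at *
      omega
    obtain ⟨F', hF', hc⟩ := exists_root_true F hmu.ge
    obtain ⟨Y0, hY0, hUY0⟩ := hA.reroot hF'
    have e : M = Y0 := mark_uniq bw (hU.symm.trans hUY0) hM hMc' (by rw [hY0.col, hc]; rfl)
    subst e
    refine ⟨sh F', hY0.sh, ?_⟩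
    intro Y hY hYG
    obtain ⟨Y1, hY1, rfl⟩ := Att.lift (X := one false) hY
    obtain ⟨Y2, hY2, hU2⟩ := hY1.reroot hF'.symm
    have := hu Y2 hY2 (hU2.sh.symm.trans (hYG.trans hU.sh.symm))
    subst this
    have e : M = Y1 := mark_uniq bw (hU.symm.trans hU2.symm) hM hMc' (by rw [hY1.col, hc]; rfl)
    rw [e]

theorem att_pl (n : ℕ) : Att (one ()) (pl n) (pl (n + 1)) := by
  induction n with
  | zero => exact Att.root _
  | succ n ih => exact Att.sub _ ih
theorem att_pl2 (n : ℕ) : Att (pl 1) (pl n) (pl (n + 2)) := by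
  induction n with
  | zero => exact Att.root _
  | succ n ih => exact Att.sub _ ih

theorem Att.deg {α : Type} {X F Y : RT α} (h : Att X F Y) : RT.deg F ≤ RT.deg Y := by
  cases h with
  | root => simp
  | sub => simp

theorem alt2_spider {x y : ℕ} (hy : 1 ≤ y) : Alt2 (up (join (up (pl x)) (pl (y + 1)))) := by
  refine ⟨up (join (up (pl x)) (pl y)), Att.sub _ (Att.sub _ (att_pl y)), ?_⟩
  intro Y hY hU
  have hG : U (s3 x (y + 1) 0) Y := (U.swap _ _).trans hU.symm
  rcases hY.inv with ⟨A', h, rfl⟩ | ⟨Z, h, rfl⟩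
  · exfalso
    have := h.inv_one
    subst this
    have he : s3 x y 1 = s3 x (y + 1) 0 := s3uniq (hG.trans (U.swap _ _)) (by simp [s3])
    rcases join_eq he with ⟨_, h1⟩ | ⟨E, h1, h2⟩
    · have := pl_inj h1; omega
    · rcases join_eq h1 with ⟨_, h3⟩ | ⟨E', h3, rfl⟩
      · have := pl_inj h3; omega
      · obtain ⟨_, h4⟩ := join_eq_up h3.symm
        have := pl_inj h4
        subst this
        rcases join_eq h2 with ⟨_, h5⟩ | ⟨E'', h5, _⟩
        · have := pl_inj h5; omega
        · obtain ⟨_, h6⟩ := join_eq_up h5.symm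
          have := pl_inj h6; omega
  · have hd := Att.deg h
    simp at hd
    have he := s3uniq (hG.trans (U.swap _ _)) (by simp; omega)
    rw [join_right_cancel he]

theorem nps_size {G : RT Unit} (h : NPs G) : 4 ≤ sz G := by
  have one1 : ∀ R : RT Unit, sz R = 1 → R = pl 0 := by
    intro R h
    obtain ⟨c, rfl⟩ := sz_eq_one h
    rfl
  have two : ∀ R : RT Unit, sz R = 2 → R = pl 1 := by
    intro R h
    rcases one_or_join R with ⟨c, rfl⟩ | ⟨A, B, rfl⟩
    · simp at h
    · have := sz_pos A
      have := sz_pos B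
      simp at h
      rw [one1 A (by omega), one1 B (by omega)]; rfl
  have hp := sz_pos G
  by_contra hc
  rcases one_or_join G with ⟨c, rfl⟩ | ⟨A, B, rfl⟩
  · exact h.1 0 0 rfl
  · have := sz_pos A
    have := sz_pos B
    simp at hc
    by_cases hA : sz A = 1
    · by_cases hB : sz B = 1
      · exact h.1 0 1 (by rw [one1 A hA, one1 B hB]; rfl)
      · exact h.1 0 2 (by rw [one1 A hA, two B (by omega)]; rfl)
    · exact h.1 1 1 (by rw [two A (by omega), one1 B (by omega)]; rfl)

/-! ### Two good cuts -/

def Alg (T : RT Unit) : Prop := ∃ A1 B1 A2 B2, U T (join A1 B1) ∧ U T (join A2 B2) ∧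
  sz A1 ≠ sz A2 ∧ sz A1 ≠ sz B2 ∧ ∀ A1' B1' A2' B2', U A1' A1 → U B1' B1 → U A2' A2 → U B2' B2 →
    U (join A1' B1') (join A2' B2') → U (join A1' B1') T

theorem alg_of {T A1 B1 F X T0 : RT Unit} (hX : ∀ B, U B X → B = X) (h1 : U T (join A1 B1))
    (hA : Att X F T0) (hT0 : U T T0) (hs1 : sz A1 ≠ sz F) (hs2 : sz A1 ≠ sz X)
    (h : ∀ A1' B1' Y, U A1' A1 → U B1' B1 → Att X F Y → U (join A1' B1') Y →
      U (join A1' B1') T) : Alg T := by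
  obtain ⟨Z, hZ, hU⟩ := hA.cut
  refine ⟨A1, B1, Z, X, h1, hT0.trans hU, by rw [hZ.sz]; exact hs1, hs2, ?_⟩
  intro A1' B1' A2' B2' u1 u2 u3 u4 u5
  have := hX _ u4
  subst this
  obtain ⟨Y, hY, hUY⟩ := (Att.root (X := B2') A2').reroot (u3.trans hZ)
  exact h _ _ Y u1 u2 hY (u5.trans hUY)

theorem alg_of2 {T F1 X1 T1 F X T0 : RT Unit} (hX : ∀ B, U B X → B = X) (hX1 : ∀ B, U B X1 → B = X1)
    (hA1 : Att X1 F1 T1) (hT1 : U T T1)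
    (hA : Att X F T0) (hT0 : U T T0) (hs1 : sz F1 ≠ sz F) (hs2 : sz F1 ≠ sz X)
    (h : ∀ Y1 Y, Att X1 F1 Y1 → Att X F Y → U Y1 Y → U Y1 T) : Alg T := by
  obtain ⟨Z, hZ, hU⟩ := hA1.cut
  refine alg_of hX (hT1.trans hU) hA hT0 (by rw [hZ.sz]; exact hs1) (by rw [hZ.sz]; exact hs2) ?_
  intro A1' B1' Y u1 u2 u3 u4
  have := hX1 _ u2
  subst this
  obtain ⟨Y1, hY1, hUY⟩ := (Att.root (X := B1') A1').reroot (u1.trans hZ)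
  exact hUY.trans (h Y1 Y hY1 u3 (hUY.symm.trans u4))

theorem u_dot : ∀ B : RT Unit, U B (one ()) → B = one () := by
  intro B h
  obtain ⟨c, rfl⟩ := sz_eq_one (R := B) (by rw [h.sz, sz_one])
  rfl
theorem u_pl1 : ∀ B : RT Unit, U B (pl 1) → B = pl 1 := by
  intro B h
  obtain ⟨i, j, h1, rfl⟩ := U.pp_inv (i := 1) (j := 0) h.symm
  rcases i with _ | _ | i
  · obtain rfl : j = 1 := by omega
    rfl
  · obtain rfl : j = 0 := by omega
    rfl
  · omega

theorem nps_U {G G' : RT Unit} (h : ∀ i j, G ≠ pp i j) (hU : U G' G) (i j : ℕ) : G' ≠ pp i j := by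
  rintro rfl
  obtain ⟨i', j', _, rfl⟩ := hU.pp_inv
  exact h _ _ rfl

theorem att_ppjj {j i' j' : ℕ} (h : Att (one ()) (pp j j) (pp i' j')) :
    pp i' j' = pp (j + 1) j := by
  rcases h.pp_inv with ⟨x, rfl, h1⟩ | ⟨y, rfl, h1⟩
  · have := pp_inj h1
    obtain ⟨rfl, rfl⟩ : x = j ∧ j' = j := by omega
    rfl
  · have := pp_inj h1
    obtain ⟨rfl, rfl⟩ : y = j ∧ i' = j := by omega
    exact pp_comm _ _

theorem att_ppj (j : ℕ) : Att (one ()) (pp j j) (pp (j + 1) j) := by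
  rw [pp_comm (j + 1)]
  cases j with
  | zero => exact Att.root _
  | succ j => exact Att.sub _ (att_pl j)

theorem alg_i {G : RT Unit} {j : ℕ} (hG : ∀ i j, G ≠ pp i j) (hj : 1 ≤ j)
    (hs : sz G = 2 * j + 2) : Alg (join G (pp (j + 1) j)) := by
  refine alg_of u_dot (U.refl _) (Att.sub G (att_ppj j)) (U.refl _) (by simp) (by simp; omega) ?_
  intro G' P' Y u1 u2 hY hU
  obtain ⟨i', j', h1, rfl⟩ := u2.symm.pp_inv
  have hsG := u1.sz
  rcases hY.inv with ⟨Gp, h, rfl⟩ | ⟨Z, h, rfl⟩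
  · have h2 := Att.sz h
    simp only [sz_one] at h2
    obtain ⟨W, rfl, ⟨h3, rfl⟩ | ⟨h3, rfl⟩⟩ := off1 (X := pp j j) (Y := Gp) (by simp; omega)
      ((U.swap _ _).trans hU.symm) (by simp; omega)
    · rcases h.to_up with ⟨rfl, _⟩ | ⟨Z0, rfl, h4⟩
      · simp at hs
      · have : ∃ a b, Z0 = pp a b := by
          rcases h4.pp_inv with ⟨x, _, h5⟩ | ⟨x, _, h5⟩
          · exact ⟨_, _, h5⟩
          · exact ⟨_, _, h5⟩
        obtain ⟨a, b, rfl⟩ := this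
        rw [← h3] at u1
        have e := upuniq u1
        rw [← e] at h4
        rw [att_ppjj h4, ← h3, e]
        exact U.refl _
    · exfalso
      obtain ⟨x, y, _, h5, _⟩ := pp_join h3.symm
      have := pp_inj (i' := y) (j' := 0) h5
      omega
  · have h2 := Att.sz h
    simp at h2
    rcases bic hU (by simp; omega) (by omega) with ⟨rfl, rfl⟩ | ⟨rfl, rfl⟩
    · rw [att_ppjj h]
      exact U.refl _
    · exact absurd rfl (hG _ _)

theorem Att.pp_inv_gen {X F : RT Unit} {i j : ℕ} (h : Att X F (pp i j)) : ∃ a b, F = pp a b := by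
  rcases h.cases' with h1 | ⟨A, B, B', rfl, h1, h2⟩
  · obtain ⟨x, y, rfl, h3, h4⟩ := pp_join h1
    exact ⟨x, 0, rfl⟩
  · obtain ⟨x, y, rfl, rfl, h4⟩ := pp_join h1
    obtain ⟨y', rfl⟩ := h2.pl_inv
    exact ⟨x, y' + 1, rfl⟩

theorem alg_iv {f : RT Unit} {l : ℕ} (hG : ∀ i j, join f (one ()) ≠ pp i j) (hl : 1 ≤ l)
    (hs : sz f = l + 2) : Alg (join (join f (one ())) (pl (l + 2))) := by
  have hfpl : ∀ n, f ≠ pl n := by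
    rintro n rfl
    exact hG n 1 rfl
  have hdf : 1 ≤ deg f := by
    rcases one_or_join f with ⟨c, rfl⟩ | ⟨A, B, rfl⟩
    · simp at hs
    · simp
  refine alg_of2 (F1 := join f (pl (l + 2))) (X1 := one ()) u_pl1 u_dot
    (Att.root _) (U.of_eq (join_swap _ _ _))
    (Att.sub (join f (one ())) (att_pl2 l)) (U.refl _) (by simp; omega) (by simp; omega) ?_
  intro Y1 Y2 hY1 hY2 hU
  have hcen : ∀ Gp, Att (pl 1) (join f (one ())) Gp → Cen (join Gp (pl l)) := by
    intro Gp h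
    have h1 := Att.sz h
    have h2 := Att.deg h
    simp at h1 h2
    apply cen_join (by simp; omega)
    rintro E D rfl
    have : 1 ≤ deg E := by simp at h2; omega
    rcases one_or_join E with ⟨c, rfl⟩ | ⟨E1, E2, rfl⟩
    · simp at this
    · have := sz_pos E1
      have := sz_pos E2
      simp at h1 ⊢; omega
  rcases hY1.inv with ⟨fp, h1, rfl⟩ | ⟨Pp, h1, rfl⟩
  · have s1 := Att.sz h1
    simp at s1
    rcases hY2.inv with ⟨Gp, h2, rfl⟩ | ⟨Z, h2, rfl⟩
    · exfalso
      have s2 := Att.sz h2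
      simp at s2
      rcases half hU.symm (hcen _ h2) (by simp; omega) with h | h
      · rcases join_eq h with ⟨rfl, _⟩ | ⟨E, rfl, rfl⟩
        · omega
        · simp at s2
          have hE := u_pl1
          have : E = pl 1 := by
            rcases one_or_join E with ⟨c, rfl⟩ | ⟨A, B, rfl⟩
            · simp at s2; omega
            · have := sz_pos A
              have := sz_pos B
              simp at s2
              obtain ⟨x, rfl⟩ := sz_eq_one (R := A) (by omega)
              obtain ⟨y, rfl⟩ := sz_eq_one (R := B) (by omega)
              rfl
          subst this
          obtain ⟨a, b, h3⟩ := Att.pp_inv_gen (i := 1) (j := l + 3) h2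
          exact hG _ _ h3
      · rcases join_eq h with ⟨rfl, _⟩ | ⟨E, _, h3⟩
        · simp at s2; omega
        · obtain ⟨_, h4⟩ := join_eq_up h3.symm
          have := pl_inj h4; omega
    · have s2 := Att.sz h2
      simp at s2
      rcases bic hU (by simp; omega) (by simp; omega) with ⟨rfl, rfl⟩ | ⟨_, h⟩
      · exact U.refl _
      · exact absurd h.symm (hG (l + 2) 0)
  · exfalso
    have s1 := Att.sz h1
    simp at s1
    rcases Att.inv (A := one ()) (B := pl (l + 1)) h1 with ⟨A', h3, rfl⟩ | ⟨L1, h3, rfl⟩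
    · have := h3.inv_one
      subst this
      rcases hY2.inv with ⟨Gp, h2, rfl⟩ | ⟨Z, h2, rfl⟩
      · have hS : SCen (join (join (join (one ()) (one ())) (pl (l + 1))) f) := by
          intro A B e
          have hB : B ∈ br (join (join (join (one ()) (one ())) (pl (l + 1))) f) := by rw [e]; simp
          have hsz := congrArg sz e
          simp at hB hsz
          rcases hB with rfl | rfl | rfl
          · omega
          · simp at hsz ⊢; omega
          · simp at hsz ⊢; omega
        have he := uni (hU.symm.trans (U.swap _ _)) (hcen _ h2) hS
        have hB : pl l ∈ br (join (join (join (one ()) (one ())) (pl (l + 1))) f) := by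
          rw [← he]; simp
        simp only [br_join, br_one, Multiset.mem_cons, Multiset.notMem_zero, or_false] at hB
        rcases hB with h | h | h
        · exact hfpl _ h.symm
        · have := pl_inj h; omega
        · have := pl_inj (n := 0) h; omega
      · have s2 := Att.sz h2
        simp at s2
        obtain ⟨W, h4, _⟩ := off1 (by simp; omega) hU (by simp; omega)
        have := congrArg deg h4
        simp at this
    · have s3 := Att.sz h3
      simp at s3
      rcases hY2.inv with ⟨Gp, h2, rfl⟩ | ⟨Z, h2, rfl⟩
      · have s2 := Att.sz h2
        simp at s2
        have hU2 : U (join Gp (pl l)) (join L1 (up f)) := by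
          refine hU.symm.trans ((U.swap _ _).trans ?_)
          rw [join_swap]
          exact U.swap _ _
        rcases half hU2 (hcen _ h2) (by simp; omega) with h | h
        · rcases join_eq h with ⟨rfl, _⟩ | ⟨E, rfl, rfl⟩
          · omega
          · simp at s2
            have : E = pl 1 := by
              rcases one_or_join E with ⟨c, rfl⟩ | ⟨A, B, rfl⟩
              · simp at s2; omega
              · have := sz_pos A
                have := sz_pos B
                simp at s2
                obtain ⟨x, rfl⟩ := sz_eq_one (R := A) (by omega)
                obtain ⟨y, rfl⟩ := sz_eq_one (R := B) (by omega)
                rfl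
            subst this
            have e : join (pl 1) (up f) = join (up (up f)) (one ()) := join_swap _ _ _
            rcases h2.inv with ⟨f', h5, h6⟩ | ⟨B', h5, h6⟩
            · rw [e] at h6
              rw [← join_right_cancel h6] at h5
              obtain ⟨m, hm⟩ := path3 _ f le_rfl h5
              exact hfpl _ hm
            · have := h5.inv_one
              subst this
              rw [e] at h6
              rcases join_eq h6 with ⟨_, h7⟩ | ⟨E, h7, _⟩
              · exact absurd h7.symm (join_ne_one _ _ _)
              · obtain ⟨_, h8⟩ := join_eq_up h7.symm
                have := congrArg deg h8
                have := congrArg sz h8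
                simp at this
                omega
        · rcases join_eq h with ⟨rfl, _⟩ | ⟨E, _, h5⟩
          · simp at s2; omega
          · obtain ⟨_, h6⟩ := join_eq_up h5.symm
            exact hfpl _ h6.symm
      · have s2 := Att.sz h2
        simp at s2
        obtain ⟨W, h4, ⟨h5, h6⟩ | ⟨h5, h6⟩⟩ := off1 (by simp; omega) hU (by simp; omega)
        · obtain ⟨h7, _⟩ := join_eq_up h5.symm
          exact hfpl 0 h7
        · obtain ⟨_, h7⟩ := join_eq_up h4
          subst h6
          rw [h7] at h3
          rcases h3.cases' with h8 | ⟨A, B, B', h8, h9, _⟩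
          · exact hfpl _ (join_right_cancel h8)
          · obtain ⟨y, rfl, _⟩ := pl_join h8
            obtain ⟨h10, _⟩ := join_eq_up h9
            exact hfpl 0 h10

theorem alg_iii {G : RT Unit} {i j : ℕ} (hG : ∀ i j, G ≠ pp i j) (h4 : 4 ≤ sz G)
    (hs : sz G = sz (pp i j)) (ha : Alt2 G) : Alg (join G (pp i j)) := by
  obtain ⟨f, hf, hu⟩ := ha
  have sf := Att.sz hf
  simp at sf hs
  by_cases hiv : G = join f (one ()) ∧ ∃ n, pp i j = pl n
  · obtain ⟨rfl, n, hn⟩ := hiv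
    have := congrArg sz hn
    simp at this
    rw [hn]
    obtain ⟨l, rfl⟩ : ∃ l, n = l + 2 := ⟨n - 2, by omega⟩
    exact alg_iv hG (by omega) (by omega)
  refine alg_of u_dot (U.refl _) (Att.left (pp i j) hf) (U.refl _) (by simp; omega)
    (by simp; omega) ?_
  intro G' P' Y u1 u2 hY hU
  obtain ⟨i', j', h1, rfl⟩ := u2.symm.pp_inv
  have hsG := u1.sz
  rcases hY.inv with ⟨fp, h, rfl⟩ | ⟨Pp, h, rfl⟩
  · have h2 := Att.sz h
    simp at h2
    rcases bic hU (by simp; omega) (by simp; omega) with ⟨rfl, h3⟩ | ⟨rfl, _⟩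
    · rw [h3, hu _ h u1]
      exact U.refl _
    · exact absurd rfl (nps_U hG u1 _ _)
  · have h2 := Att.sz h
    simp at h2
    obtain ⟨W, rfl, h3⟩ := off1 (by omega) hU.symm (by simp; omega)
    rcases h.to_up with ⟨h4, _⟩ | ⟨P1, h4, h5⟩
    · have := congrArg sz h4
      simp at this; omega
    obtain ⟨x, y, h6, rfl, h7⟩ := pp_join h4
    have hP : pp i j = pl (y + 1) := h4
    rcases h3 with ⟨h3, rfl⟩ | ⟨h3, rfl⟩
    · exfalso
      apply hiv
      refine ⟨?_, _, hP⟩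
      refine (hu _ (Att.root _) ?_).symm
      refine (U.swap _ _).trans ?_
      change U (up f) G
      rw [h3]
      exact u1
    · obtain ⟨x', y', h8, rfl, h9⟩ := pp_join h3.symm
      have e1 := congrArg sz h3
      have e2 := congrArg sz hP
      simp at e1 e2 sf
      obtain rfl : y' = y := by omega
      rw [hu _ h5 u1, ← h3, hP]
      exact U.refl _

theorem alg_ii {G : RT Unit} {i j : ℕ} (hN : NPs G)
    (hs : sz G = sz (pp i j)) (hi : i ≠ j + 1) (hj : j ≠ i + 1) (ha : Alt1 G) (hna : ¬ Alt2 G) :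
    Alg (join G (pp i j)) := by
  obtain ⟨f, rfl, hu⟩ := ha
  have hG := hN.1
  simp at hs
  refine ⟨up f, pp i j, f, up (pp i j), U.refl _, ?_, by simp, by simp; omega, ?_⟩
  · rw [join_swap]
    exact U.swap _ _
  intro G' P' f' Z u1 u2 u3 u4 hU
  obtain ⟨i', j', h1, rfl⟩ := u2.symm.pp_inv
  have s1 := u1.sz
  have s3' := u3.sz
  have s4 := u4.sz
  simp at s1 s3' s4
  obtain ⟨W, rfl, ⟨rfl, rfl⟩ | ⟨h2, rfl⟩⟩ := off1 (by omega) hU.symm (by simp; omega)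
  · rw [hu _ u3 u1, upuniq u4]
    exact U.refl _
  · exfalso
    obtain ⟨a, b, h3, rfl, h4⟩ := pp_join h2.symm
    obtain ⟨x0, y0, h5, rfl⟩ := U.pp_inv (i := b) (j := 0) u3
    rcases pp_cases x0 y0 with ⟨n, h6, _⟩ | ⟨x, y, rfl, rfl, h6⟩
    · exact hG (n + 1) 0 (by rw [h6]; rfl)
    rw [h6] at hna u1
    have hy : y ≤ 1 := by
      by_contra hc
      obtain ⟨y', rfl⟩ : ∃ y', y = y' + 1 := ⟨y - 1, by omega⟩
      exact hna (alt2_spider (by omega))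
    have hx : x ≤ 1 := by
      by_contra hc
      obtain ⟨x', rfl⟩ : ∃ y', x = y' + 1 := ⟨x - 1, by omega⟩
      apply hna
      rw [join_swap]
      exact alt2_spider (by omega)
    have u5 : U W (s3 x y 0) := u1.trans (U.swap _ _)
    obtain ⟨Y, hY, hUY⟩ := (Att.root (X := one ()) W).reroot u5
    have hdY := Att.deg hY
    simp [s3] at hdY
    have u6 : U Y (up (pp i j)) := hUY.symm.trans ((U.swap _ _).trans u4)
    have hs112 : ¬ (x + y = 1) := by
      intro h
      apply hN.2.1
      rw [h6]
      refine (U.swap _ _).trans (U.of_eq ?_)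
      change s3 x y 0 = s3 0 0 1
      rcases x with _ | x
      · obtain rfl : y = 1 := by omega
        exact s3_swap2 _ _ _
      · obtain rfl : y = 0 := by omega
        obtain rfl : x = 0 := by omega
        rw [s3_swap1, s3_swap2]
    rcases pp_cases i j with ⟨n, h7, _⟩ | ⟨p, q, rfl, rfl, h7⟩
    · rw [h7] at u6
      obtain ⟨c, d, _, rfl⟩ := U.pp_inv (i := n + 1) (j := 0) u6.symm
      have := deg_pp c d
      omega
    · rw [h7] at u6
      have u7 : U (s3 p q 0) Y := (U.swap _ _).trans u6.symm
      have := s3uniq u7 hdY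
      subst this
      simp at hs
      have key : ∀ m, m = p ∨ m = q → m ≤ 2 := by
        intro m hm
        obtain ⟨A, hA⟩ : ∃ A, s3 p q 0 = join A (pl m) := by
          apply exists_join_of_mem
          rcases hm with rfl | rfl <;> simp [s3]
        rw [hA] at hY
        rcases hY.branch with h | ⟨A0, B0, h, h8⟩
        · have := pl_inj (n := 0) h
          omega
        · have hB : B0 ∈ br (s3 x y 0) := by rw [h]; simp
          simp only [s3, br_join, br_one, Multiset.mem_cons, Multiset.notMem_zero, or_false] at hB
          rcases hB with rfl | rfl | rfl
          · simp at h8; omega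
          · simp at h8; omega
          · simp at h8; omega
      have k1 := key p (Or.inl rfl)
      have k2 := key q (Or.inr rfl)
      omega

theorem alg_main {G : RT Unit} {i j : ℕ} (hN : NPs G) (hs : sz G = sz (pp i j)) :
    Alg (join G (pp i j)) := by
  have h4 := nps_size hN
  have hs' := hs
  simp at hs'
  by_cases h1 : i = j + 1
  · subst h1
    exact alg_i hN.1 (by omega) (by omega)
  by_cases h2 : j = i + 1
  · subst h2
    rw [pp_comm]
    exact alg_i hN.1 (by omega) (by omega)
  by_cases h3 : Alt2 G
  · exact alg_iii hN.1 h4 hs h3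
  · exact alg_ii hN hs h1 h2 ((key_alt hN).resolve_right h3) h3

end RT

/-! ### Graphs of rooted trees -/

/-- Disjoint union. -/
def sm {X Y : Type} (G : SimpleGraph X) (H : SimpleGraph Y) : SimpleGraph (X ⊕ Y) where
  Adj := fun u v => match u, v with
    | Sum.inl a, Sum.inl b => G.Adj a b
    | Sum.inr a, Sum.inr b => H.Adj a b
    | _, _ => False
  symm := ⟨by
    rintro (a | a) (b | b) h
    · exact SimpleGraph.Adj.symm (G := G) h
    · exact h
    · exact h
    · exact SimpleGraph.Adj.symm (G := H) h⟩
  loopless := ⟨by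
    rintro (a | a) h
    · exact G.loopless.irrefl a h
    · exact H.loopless.irrefl a h⟩

/-- Disjoint union plus one connecting edge. -/
def glue {X Y : Type} (G : SimpleGraph X) (H : SimpleGraph Y) (x : X) (y : Y) :
    SimpleGraph (X ⊕ Y) where
  Adj := fun u v => match u, v with
    | Sum.inl a, Sum.inl b => G.Adj a b
    | Sum.inr a, Sum.inr b => H.Adj a b
    | Sum.inl a, Sum.inr b => a = x ∧ b = y
    | Sum.inr b, Sum.inl a => a = x ∧ b = y
  symm := ⟨by
    rintro (a | a) (b | b) h
    · exact SimpleGraph.Adj.symm (G := G) h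
    · exact h
    · exact h
    · exact SimpleGraph.Adj.symm (G := H) h⟩
  loopless := ⟨by
    rintro (a | a) h
    · exact G.loopless.irrefl a h
    · exact H.loopless.irrefl a h⟩

section
variable {X Y X' Y' Z : Type} {G : SimpleGraph X} {H : SimpleGraph Y} {G' : SimpleGraph X'}
  {H' : SimpleGraph Y'} {K : SimpleGraph Z} {x : X} {y : Y} {x' : X'} {y' : Y'} {z : Z}

@[simp] theorem sm_ll (a b : X) : (sm G H).Adj (.inl a) (.inl b) ↔ G.Adj a b := Iff.rfl
@[simp] theorem sm_rr (a b : Y) : (sm G H).Adj (.inr a) (.inr b) ↔ H.Adj a b := Iff.rfl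
@[simp] theorem sm_lr (a : X) (b : Y) : (sm G H).Adj (.inl a) (.inr b) ↔ False := Iff.rfl
@[simp] theorem sm_rl (a : X) (b : Y) : (sm G H).Adj (.inr b) (.inl a) ↔ False := Iff.rfl
@[simp] theorem glue_ll (a b : X) : (glue G H x y).Adj (.inl a) (.inl b) ↔ G.Adj a b := Iff.rfl
@[simp] theorem glue_rr (a b : Y) : (glue G H x y).Adj (.inr a) (.inr b) ↔ H.Adj a b := Iff.rfl
@[simp] theorem glue_lr (a : X) (b : Y) :
    (glue G H x y).Adj (.inl a) (.inr b) ↔ a = x ∧ b = y := Iff.rfl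
@[simp] theorem glue_rl (a : X) (b : Y) :
    (glue G H x y).Adj (.inr b) (.inl a) ↔ a = x ∧ b = y := Iff.rfl

def glueCongr (f : G ≃g G') (g : H ≃g H') (hf : f x = x') (hg : g y = y') :
    glue G H x y ≃g glue G' H' x' y' where
  toEquiv := Equiv.sumCongr f.toEquiv g.toEquiv
  map_rel_iff' := by
    rw [← hf, ← hg]
    rintro (a | a) (b | b)
    · exact f.map_rel_iff
    · show f a = f x ∧ g b = g y ↔ _
      simp
    · show f b = f x ∧ g a = g y ↔ _
      simp
    · exact g.map_rel_iff

def glueComm (G : SimpleGraph X) (H : SimpleGraph Y) (x : X) (y : Y) :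
    glue G H x y ≃g glue H G y x where
  toEquiv := Equiv.sumComm X Y
  map_rel_iff' := by
    rintro (a | a) (b | b)
    · exact Iff.rfl
    · exact and_comm
    · exact and_comm
    · exact Iff.rfl

def glueSwap (G : SimpleGraph X) (H : SimpleGraph Y) (K : SimpleGraph Z) (x : X) (y : Y) (z : Z) :
    glue (glue G H x y) K (.inl x) z ≃g glue (glue G K x z) H (.inl x) y where
  toEquiv :=
    { toFun := fun
        | .inl (.inl a) => .inl (.inl a)
        | .inl (.inr b) => .inr b
        | .inr c => .inl (.inr c)
      invFun := fun
        | .inl (.inl a) => .inl (.inl a)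
        | .inl (.inr b) => .inr b
        | .inr c => .inl (.inr c)
      left_inv := by rintro ((a | a) | a) <;> rfl
      right_inv := by rintro ((a | a) | a) <;> rfl }
  map_rel_iff' := by
    rintro ((a | a) | a) ((b | b) | b) <;> simp

def smComm (G : SimpleGraph X) (H : SimpleGraph Y) : sm G H ≃g sm H G where
  toEquiv := Equiv.sumComm X Y
  map_rel_iff' := by
    rintro (a | a) (b | b) <;> exact Iff.rfl

/-- Deleting the connecting edge. -/
def delGlue {V : Type} {T : SimpleGraph V} (ψ : T ≃g glue G H x y) {a b : V}
    (ha : ψ a = .inl x) (hb : ψ b = .inr y) : T.deleteEdges {s(a, b)} ≃g sm G H where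
  toEquiv := ψ.toEquiv
  map_rel_iff' := by
    intro u v
    have h1 := ψ.map_rel_iff (a := u) (b := v)
    have key : s(u, v) = s(a, b) ↔ s(ψ u, ψ v) = s(Sum.inl x, Sum.inr y) := by
      rw [← ha, ← hb]
      simp
    rw [deleteEdges_adj, Set.mem_singleton_iff, key, ← h1]
    show (sm G H).Adj (ψ u) (ψ v) ↔ _
    rcases ψ u with u' | u' <;> rcases ψ v with v' | v' <;> simp
    tauto

/-- Restoring a connecting edge. -/
def addGlue {V : Type} {T : SimpleGraph V} {a b : V} (hab : T.Adj a b)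
    (ψ : T.deleteEdges {s(a, b)} ≃g sm G H)
    (ha : ψ a = .inl x) (hb : ψ b = .inr y) : T ≃g glue G H x y where
  toEquiv := ψ.toEquiv
  map_rel_iff' := by
    intro u v
    have h1 := ψ.map_rel_iff (a := u) (b := v)
    have key : s(u, v) = s(a, b) ↔ s(ψ u, ψ v) = s(Sum.inl x, Sum.inr y) := by
      rw [← ha, ← hb]
      simp
    rw [deleteEdges_adj, Set.mem_singleton_iff] at h1
    show (glue G H x y).Adj (ψ u) (ψ v) ↔ _
    by_cases hk : s(u, v) = s(a, b)
    · have hT : T.Adj u v := by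
        rw [← mem_edgeSet, hk]; exact hab
      have hk' := key.1 hk
      simp only [hT, iff_true]
      rw [← mem_edgeSet, hk', mem_edgeSet]
      simp
    · rw [← and_iff_left (a := T.Adj u v) hk, ← h1]
      rw [key] at hk
      revert hk
      rcases ψ u with u' | u' <;> rcases ψ v with v' | v' <;> simp
      tauto
end

namespace Pre

def Vt : Pre Unit → Type
  | .one _ => Unit
  | .join A B => Vt A ⊕ Vt B

def root : (p : Pre Unit) → Vt p
  | .one _ => ()
  | .join A _ => Sum.inl (root A)

def gr : (p : Pre Unit) → SimpleGraph (Vt p)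
  | .one _ => (⊥ : SimpleGraph Unit)
  | .join A B => glue (gr A) (gr B) (root A) (root B)

theorem finite_Vt : (p : Pre Unit) → Finite (Vt p)
  | .one _ => inferInstanceAs (Finite Unit)
  | .join A B => by
    have := finite_Vt A
    have := finite_Vt B
    exact inferInstanceAs (Finite (Vt A ⊕ Vt B))

instance (p : Pre Unit) : Finite (Vt p) := finite_Vt p

theorem card_Vt (p : Pre Unit) : Nat.card (Vt p) = RT.sz (RT.mk p) := by
  induction p with
  | one c => exact Nat.card_unique (α := Unit)
  | join A B ha hb =>
    rw [RT.mk_join, RT.sz_join, ← ha, ← hb]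
    exact Nat.card_sum

theorem gr_ind (p : Pre Unit) : ∀ P : Vt p → Prop, P p.root →
    (∀ a b, p.gr.Adj a b → P a → P b) → ∀ a, P a := by
  induction p with
  | one c => intro P h _ a; exact h
  | join A B ha hb =>
    intro P h hs
    have hl : ∀ a : Vt A, P (Sum.inl a) := ha (fun a => P (Sum.inl a)) h
      (fun a b hab => hs (Sum.inl a) (Sum.inl b) hab)
    have hr : ∀ a : Vt B, P (Sum.inr a) := hb (fun a => P (Sum.inr a))
      (hs (Sum.inl A.root) (Sum.inr B.root) ⟨rfl, rfl⟩ (hl _))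
      (fun a b hab => hs (Sum.inr a) (Sum.inr b) hab)
    rintro (a | a)
    · exact hl a
    · exact hr a

theorem gr_reach (p : Pre Unit) (a : Vt p) : p.gr.Reachable p.root a :=
  gr_ind p (fun a => p.gr.Reachable p.root a) (Reachable.refl _)
    (fun _ _ h h' => h'.trans h.reachable) a

theorem gr_reach2 (p : Pre Unit) (a b : Vt p) : p.gr.Reachable a b :=
  (gr_reach p a).symm.trans (gr_reach p b)

/-- Rooted isomorphism. -/
def RI (p q : Pre Unit) : Prop := ∃ f : p.gr ≃g q.gr, f p.root = q.root

theorem RI.refl (p : Pre Unit) : RI p p := ⟨Iso.refl, rfl⟩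
theorem RI.symm {p q : Pre Unit} (h : RI p q) : RI q p := by
  obtain ⟨f, hf⟩ := h
  exact ⟨f.symm, by rw [← hf]; exact f.symm_apply_apply _⟩
theorem RI.trans {p q r : Pre Unit} (h : RI p q) (h' : RI q r) : RI p r := by
  obtain ⟨f, hf⟩ := h
  obtain ⟨g, hg⟩ := h'
  exact ⟨f.trans g, by show g (f _) = _; rw [hf, hg]⟩
theorem RI.join {p q p' q' : Pre Unit} (h : RI p p') (h' : RI q q') :
    RI (.join p q) (.join p' q') := by
  obtain ⟨f, hf⟩ := h
  obtain ⟨g, hg⟩ := h'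
  exact ⟨glueCongr f g hf hg, congrArg Sum.inl hf⟩

end Pre

section
variable {X Y X' Y' : Type} {G : SimpleGraph X} {H : SimpleGraph Y} {G' : SimpleGraph X'}
  {H' : SimpleGraph Y'}

theorem sm_reach_left {a : X} {v : X ⊕ Y} (h : (sm G H).Reachable (.inl a) v) :
    ∃ b, v = .inl b := by
  obtain ⟨w⟩ := h
  generalize hu : (Sum.inl a : X ⊕ Y) = u at w
  induction w generalizing a with
  | nil => exact ⟨a, hu.symm⟩
  | @cons u v w h p ih =>
    subst hu
    rcases v with v | v
    · exact ih rfl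
    · exact h.elim

theorem sm_reach_right {a : Y} {v : X ⊕ Y} (h : (sm G H).Reachable (.inr a) v) :
    ∃ b, v = .inr b := by
  obtain ⟨w⟩ := h
  generalize hu : (Sum.inr a : X ⊕ Y) = u at w
  induction w generalizing a with
  | nil => exact ⟨a, hu.symm⟩
  | @cons u v w h p ih =>
    subst hu
    rcases v with v | v
    · exact h.elim
    · exact ih rfl

theorem sm_reach_ll {a b : X} (h : G.Reachable a b) : (sm G H).Reachable (.inl a) (.inl b) :=
  h.map (⟨Sum.inl, fun h => h⟩ : G →g sm G H)

theorem sm_reach_rr {a b : Y} (h : H.Reachable a b) : (sm G H).Reachable (.inr a) (.inr b) :=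
  h.map (⟨Sum.inr, fun h => h⟩ : H →g sm G H)

theorem sm_split (hG : G.Preconnected) (hG' : G'.Preconnected) (χ : sm G H ≃g sm G' H')
    {x : X} {x' : X'} (hx : χ (.inl x) = .inl x') :
    ∃ f : G ≃g G', ∀ a, χ (.inl a) = .inl (f a) := by
  have h1 : ∀ a, ∃ b, χ (.inl a) = .inl b := by
    intro a
    have h := (χ.reachable_iff).2 (sm_reach_ll (H := H) (hG x a))
    rw [hx] at h
    exact sm_reach_left h
  have hx' : χ.symm (.inl x') = .inl x := by rw [← hx]; exact χ.symm_apply_apply _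
  have h2 : ∀ a, ∃ b, χ.symm (.inl a) = .inl b := by
    intro a
    have h := (χ.symm.reachable_iff).2 (sm_reach_ll (H := H') (hG' x' a))
    rw [hx'] at h
    exact sm_reach_left h
  choose f hf using h1
  choose g hg using h2
  refine ⟨⟨⟨f, g, ?_, ?_⟩, ?_⟩, hf⟩
  · intro a
    have : (Sum.inl (g (f a)) : X ⊕ Y) = .inl a := by
      rw [← hg, ← hf]; exact χ.symm_apply_apply _
    exact Sum.inl_injective this
  · intro a
    have : (Sum.inl (f (g a)) : X' ⊕ Y') = .inl a := by
      rw [← hf, ← hg]; exact χ.apply_symm_apply _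
    exact Sum.inl_injective this
  · intro a b
    have := χ.map_rel_iff (a := Sum.inl a) (b := Sum.inl b)
    rw [hf, hf] at this
    exact this
end

namespace Pre

theorem RI.of_rel {p q : Pre Unit} (h : Pre.Rel p q) : RI p q := by
  induction h with
  | swap A B C => exact ⟨glueSwap A.gr B.gr C.gr A.root B.root C.root, rfl⟩
  | left B _ ih => exact ih.join (RI.refl B)
  | right A _ ih => exact (RI.refl A).join ih

theorem RI.of_eq {p q : Pre Unit} (h : RT.mk p = RT.mk q) : RI p q := by
  have hE := Quot.eqvGen_exact h
  clear h
  induction hE with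
  | rel p q h => exact RI.of_rel h
  | refl p => exact RI.refl p
  | symm p q _ ih => exact ih.symm
  | trans p q r _ _ ih1 ih2 => exact ih1.trans ih2

theorem Uiso {R S : RT Unit} (h : RT.U R S) : ∀ p q : Pre Unit, RT.mk p = R → RT.mk q = S →
    Nonempty (p.gr ≃g q.gr) := by
  unfold RT.U at h
  induction h with
  | refl =>
    rintro p q rfl h
    obtain ⟨f, _⟩ := RI.of_eq h
    exact ⟨f.symm⟩
  | tail h1 h2 ih =>
    intro p q hp hq
    obtain ⟨A, B, rfl, rfl⟩ := h2
    obtain ⟨A, rfl⟩ := Quot.exists_rep A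
    obtain ⟨B, rfl⟩ := Quot.exists_rep B
    obtain ⟨f⟩ := ih p (.join A B) hp rfl
    obtain ⟨g, _⟩ := RI.of_eq (p := q) (q := .join B A) hq
    exact ⟨(f.trans (glueComm A.gr B.gr A.root B.root)).trans g.symm⟩

theorem nbr (q : Pre Unit) : ∀ y : Vt q, q.gr.Adj q.root y →
    ∃ A B : Pre Unit, RT.mk q = RT.join (RT.mk A) (RT.mk B) ∧
    ∃ ψ : q.gr ≃g glue A.gr B.gr A.root B.root,
      ψ q.root = .inl A.root ∧ ψ y = .inr B.root := by
  induction q with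
  | one c => intro y h; exact h.elim
  | join C D hC hD =>
    rintro (c | d) h
    · obtain ⟨A, B, hm, ψ, h1, h2⟩ := hC c h
      refine ⟨.join A D, B, ?_, ?_⟩
      · rw [RT.mk_join, RT.mk_join, hm, RT.join_swap]
      · refine ⟨(glueCongr ψ (Iso.refl (G := D.gr)) h1 rfl).trans
          (glueSwap A.gr B.gr D.gr A.root B.root D.root), ?_, ?_⟩
        · show glueSwap A.gr B.gr D.gr A.root B.root D.root (Sum.inl (ψ C.root)) = _
          rw [h1]; rfl
        · show glueSwap A.gr B.gr D.gr A.root B.root D.root (Sum.inl (ψ c)) = _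
          rw [h2]; rfl
    · refine ⟨C, D, rfl, Iso.refl, rfl, ?_⟩
      obtain ⟨_, rfl⟩ := (show C.root = C.root ∧ d = D.root from h)
      rfl

theorem reroot (p : Pre Unit) : ∀ x : Vt p, ∃ q : Pre Unit, RT.U (RT.mk q) (RT.mk p) ∧
    ∃ f : q.gr ≃g p.gr, f q.root = x := by
  apply gr_ind
  · exact ⟨p, RT.U.refl _, Iso.refl, rfl⟩
  · rintro a b hab ⟨q, hU, f, hf⟩
    have hadj : q.gr.Adj q.root (f.symm b) := by
      rw [← f.map_rel_iff, hf]
      simpa using hab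
    obtain ⟨A, B, hm, ψ, h1, h2⟩ := nbr q _ hadj
    refine ⟨.join B A, ?_, ((glueComm B.gr A.gr B.root A.root).trans ψ.symm).trans f, ?_⟩
    · rw [RT.mk_join]
      exact (RT.U.swap _ _).trans ((RT.U.of_eq hm.symm).trans hU)
    · show f (ψ.symm (Sum.inr B.root)) = b
      rw [← h2]
      simp

theorem gr_pre (p : Pre Unit) : p.gr.Preconnected := gr_reach2 p

theorem RI.eq {p q : Pre Unit} (h : RI p q) : RT.mk p = RT.mk q := by
  induction p generalizing q with
  | one c =>
    obtain ⟨f, hf⟩ := h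
    cases q with
    | one d => rfl
    | join A B =>
      exfalso
      have : f.symm (Sum.inl A.root : Vt A ⊕ Vt B) = f.symm (Sum.inr B.root : Vt A ⊕ Vt B) :=
        Subsingleton.elim (α := Unit) _ _
      have := f.symm.injective this
      exact Sum.inl_ne_inr this
  | join A B hA hB =>
    obtain ⟨f, hf⟩ := h
    have hadj : q.gr.Adj q.root (f (Sum.inr B.root : Vt A ⊕ Vt B)) := by
      rw [← hf]
      exact f.map_rel_iff.2 (show A.root = A.root ∧ B.root = B.root from ⟨rfl, rfl⟩)
    obtain ⟨A', B', hm, ψ, h1, h2⟩ := nbr q _ hadj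
    rw [hm, RT.mk_join]
    have θ : ∃ θ : glue A.gr B.gr A.root B.root ≃g glue A'.gr B'.gr A'.root B'.root,
      θ (.inl A.root) = .inl A'.root ∧ θ (.inr B.root) = .inr B'.root :=
      ⟨RelIso.trans f ψ, by
        show ψ (f _) = _
        rw [← h1, ← hf]; rfl, h2⟩
    obtain ⟨θ, t1, t2⟩ := θ
    have t1' : θ.symm (.inl A'.root) = .inl A.root := by rw [← t1]; exact θ.symm_apply_apply _
    have t2' : θ.symm (.inr B'.root) = .inr B.root := by rw [← t2]; exact θ.symm_apply_apply _
    let χ0 := delGlue (Iso.refl (G := glue A.gr B.gr A.root B.root)) (a := .inl A.root)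
      (b := .inr B.root) rfl rfl
    let χ := χ0.symm.trans (delGlue θ t1 t2)
    have hχ1 : χ (.inl A.root) = .inl A'.root := t1
    have hχ2 : χ (.inr B.root) = .inr B'.root := t2
    obtain ⟨g, hg⟩ := sm_split A.gr_pre A'.gr_pre χ hχ1
    obtain ⟨g', hg'⟩ := sm_split B.gr_pre B'.gr_pre
      (((smComm B.gr A.gr).trans χ).trans (smComm A'.gr B'.gr)) (x := B.root) (x' := B'.root) (by
        show smComm A'.gr B'.gr (χ (.inr B.root)) = _
        rw [hχ2]; rfl)
    rw [hA ⟨g, ?_⟩, hB ⟨g', ?_⟩]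
    · have := hg' B.root
      apply Sum.inl_injective (β := Vt A')
      rw [← this]
      show smComm A'.gr B'.gr (χ (.inr B.root)) = _
      rw [hχ2]; rfl
    · apply Sum.inl_injective (β := Vt B')
      rw [← hg, hχ1]

theorem U_of_iso {p q : Pre Unit} (f : p.gr ≃g q.gr) : RT.U (RT.mk p) (RT.mk q) := by
  obtain ⟨q', hU, g, hg⟩ := reroot q (f p.root)
  have : RI p q' := ⟨f.trans g.symm, by
    show g.symm (f p.root) = _
    rw [← hg]; exact g.symm_apply_apply _⟩
  rw [this.eq]
  exact hU

end Pre

/-! ### Trees are graphs of rooted trees -/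

theorem leaf_glue {V : Type} (G : SimpleGraph V) (u v : V) (h : ∀ w, G.Adj v w ↔ w = u)
    (hu : u ∈ ({v}ᶜ : Set V)) :
    Nonempty (G ≃g glue (G.induce ({v}ᶜ : Set V)) (⊥ : SimpleGraph Unit) ⟨u, hu⟩ ()) := by
  let F : ({v}ᶜ : Set V) ⊕ Unit → V := fun
    | .inl x => x.1
    | .inr _ => v
  have hF : Function.Bijective F := by
    constructor
    · rintro (x | x) (y | y) hxy
      · exact congrArg Sum.inl (Subtype.ext hxy)
      · exact (x.2 hxy).elim
      · exact (y.2 hxy.symm).elim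
      · rfl
    · intro w
      by_cases hw : w = v
      · exact ⟨.inr (), hw.symm⟩
      · exact ⟨.inl ⟨w, hw⟩, rfl⟩
  refine ⟨RelIso.symm ⟨Equiv.ofBijective F hF, ?_⟩⟩
  rintro (⟨x, hx⟩ | x) (⟨y, hy⟩ | y)
  · exact Iff.rfl
  · show G.Adj x v ↔ (⟨x, hx⟩ : ({v}ᶜ : Set V)) = ⟨u, hu⟩ ∧ y = ()
    rw [G.adj_comm, h]; simp
  · show G.Adj v y ↔ (⟨y, hy⟩ : ({v}ᶜ : Set V)) = ⟨u, hu⟩ ∧ x = ()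
    rw [h]; simp
  · show G.Adj v v ↔ False
    simp

theorem exists_pre (n : ℕ) : ∀ (V : Type) [Finite V] (G : SimpleGraph V), G.IsTree →
    Nat.card V = n → ∃ p : Pre Unit, Nonempty (G ≃g p.gr) := by
  induction n with
  | zero =>
    intro V _ G hG hc
    have := hG.connected.nonempty
    have := Nat.card_pos (α := V)
    omega
  | succ n ih =>
    intro V _ G hG hc
    classical
    have := Fintype.ofFinite V
    rcases subsingleton_or_nontrivial V with hs | hs
    · refine ⟨.one (), ?_⟩
      obtain ⟨v0⟩ := hG.connected.nonempty
      have : Inhabited V := ⟨v0⟩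
      have : Unique V := Unique.mk' V
      refine ⟨⟨Equiv.ofUnique V Unit, ?_⟩⟩
      intro a b
      have : a = b := Subsingleton.elim _ _
      subst this
      simp
    · obtain ⟨v, hv⟩ := hG.exists_vert_degree_one_of_nontrivial
      have hc' := hG.connected.induce_compl_singleton_of_degree_eq_one hv
      have ht : (G.induce ({v}ᶜ : Set V)).IsTree := ⟨hc', hG.isAcyclic.induce _⟩
      obtain ⟨u, hu, huu⟩ := degree_eq_one_iff_existsUnique_adj.mp hv
      have hadj : ∀ w, G.Adj v w ↔ w = u := fun w => ⟨huu w, fun h => h ▸ hu⟩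
      have hu' : u ∈ ({v}ᶜ : Set V) := hu.ne'
      obtain ⟨e⟩ := leaf_glue G u v hadj hu'
      have hcard : Nat.card ({v}ᶜ : Set V) = n := by
        have := Nat.card_congr e.toEquiv
        rw [Nat.card_sum, hc] at this
        simp at this ⊢
        omega
      obtain ⟨p, ⟨f⟩⟩ := ih _ _ ht hcard
      obtain ⟨q, -, g, hg⟩ := p.reroot (f ⟨u, hu'⟩)
      refine ⟨.join q (.one ()), ⟨e.trans (glueCongr (f.trans g.symm) Iso.refl ?_ rfl)⟩⟩
      show g.symm (f _) = _
      rw [← hg]; exact g.symm_apply_apply _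

theorem tree_split {V : Type} [Finite V] (T : SimpleGraph V) (hT : T.IsTree) {a b : V}
    (hab : T.Adj a b) : ∃ A B : Pre Unit, ∃ ψ : T ≃g glue A.gr B.gr A.root B.root,
      ψ a = .inl A.root ∧ ψ b = .inr B.root := by
  obtain ⟨p, ⟨f⟩⟩ := exists_pre _ V T hT rfl
  obtain ⟨q, -, g, hg⟩ := p.reroot (f a)
  have hadj : q.gr.Adj q.root (g.symm (f b)) := by
    rw [← g.map_rel_iff, hg]
    rw [RelIso.apply_symm_apply]
    exact f.map_rel_iff.2 hab
  obtain ⟨A, B, -, ψ, h1, h2⟩ := q.nbr _ hadj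
  refine ⟨A, B, (f.trans g.symm).trans ψ, ?_, h2⟩
  show ψ (g.symm (f a)) = _
  rw [← hg, ← h1]; simp

/-! ### Components -/
section
variable {X Y V : Type} {G : SimpleGraph X} {H : SimpleGraph Y} {K : SimpleGraph V}

theorem comp_iso (hG : G.Preconnected) (χ : K ≃g sm G H) {a : V} {x : X} (ha : χ a = .inl x) :
    Nonempty (K.induce (K.connectedComponentMk a).supp ≃g G) := by
  have key : ∀ v, K.Reachable v a ↔ ∃ y, χ v = .inl y := by
    intro v
    rw [← χ.reachable_iff, ha]
    constructor
    · intro h; exact sm_reach_left h.symm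
    · rintro ⟨y, hy⟩
      rw [hy]; exact sm_reach_ll (hG _ _)
  let F : X → (K.connectedComponentMk a).supp := fun y => ⟨χ.symm (.inl y), by
    rw [ConnectedComponent.mem_supp_iff, ConnectedComponent.eq, key]
    exact ⟨y, χ.apply_symm_apply _⟩⟩
  have hF : Function.Bijective F := by
    constructor
    · intro y z h
      have : χ.symm (.inl y) = χ.symm (.inl z) := congrArg Subtype.val h
      exact Sum.inl_injective (χ.symm.injective this)
    · rintro ⟨v, hv⟩
      rw [ConnectedComponent.mem_supp_iff, ConnectedComponent.eq, key] at hv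
      obtain ⟨y, hy⟩ := hv
      exact ⟨y, Subtype.ext (by show χ.symm (.inl y) = v; rw [← hy]; exact χ.symm_apply_apply _)⟩
  refine ⟨RelIso.symm ⟨Equiv.ofBijective F hF, ?_⟩⟩
  intro y z
  show K.Adj (χ.symm (.inl y)) (χ.symm (.inl z)) ↔ _
  rw [χ.symm.map_rel_iff]; rfl

theorem cls_left (hG : G.Preconnected) (χ : K ≃g sm G H) {a : V} {x : X} (ha : χ a = .inl x) :
    {v | K.Reachable a v}.ncard = Nat.card X := by
  have key : {v | K.Reachable a v} = χ.symm '' (Set.range Sum.inl) := by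
    ext v
    simp only [Set.mem_ofPred_eq, ← Set.range_comp, Set.mem_range, Function.comp]
    rw [← χ.reachable_iff, ha]
    constructor
    · intro h
      obtain ⟨b, hb⟩ := sm_reach_left h
      exact ⟨b, by rw [← hb]; exact χ.symm_apply_apply _⟩
    · rintro ⟨y, rfl⟩
      rw [χ.apply_symm_apply]; exact sm_reach_ll (hG _ _)
  rw [key, Set.ncard_image_of_injective _ χ.symm.injective, ← Nat.card_coe_set_eq,
    Nat.card_range_of_injective Sum.inl_injective]

theorem cls_right (hH : H.Preconnected) (χ : K ≃g sm G H) {a : V} {y : Y} (ha : χ a = .inr y) :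
    {v | K.Reachable a v}.ncard = Nat.card Y :=
  cls_left hH (χ.trans (smComm G H)) (x := y) (by
    show smComm G H (χ a) = _
    rw [ha]; rfl)
end

/-! ### Paths and spiders -/

def prePl : ℕ → Pre Unit
  | 0 => .one ()
  | n + 1 => .join (.one ()) (prePl n)

theorem mk_prePl (n : ℕ) : RT.mk (prePl n) = RT.pl n := by
  induction n with
  | zero => rfl
  | succ n ih =>
    rw [prePl, RT.mk_join, ih]; rfl

theorem path_glue (n : ℕ) : ∃ e : pathGraph (n + 2) ≃g
    glue (⊥ : SimpleGraph Unit) (pathGraph (n + 1)) () 0, e 0 = .inl () := by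
  let F : Unit ⊕ Fin (n + 1) → Fin (n + 2) := fun
    | .inl _ => 0
    | .inr i => i.succ
  have hF : Function.Bijective F := by
    constructor
    · rintro (x | x) (y | y) hxy
      · rfl
      · exact (Fin.succ_ne_zero _ hxy.symm).elim
      · exact (Fin.succ_ne_zero _ hxy).elim
      · exact congrArg Sum.inr (Fin.succ_injective _ hxy)
    · intro w
      rcases Fin.eq_zero_or_eq_succ w with rfl | ⟨j, rfl⟩
      · exact ⟨.inl (), rfl⟩
      · exact ⟨.inr j, rfl⟩
  have hR : ∀ x y, (pathGraph (n + 2)).Adj (F x) (F y) ↔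
      (glue (⊥ : SimpleGraph Unit) (pathGraph (n + 1)) () 0).Adj x y := by
    rintro (x | x) (y | y)
    · show (pathGraph (n + 2)).Adj 0 0 ↔ False
      simp
    · show (pathGraph (n + 2)).Adj 0 y.succ ↔ x = () ∧ y = 0
      rw [pathGraph_adj, Fin.ext_iff]
      simp only [Fin.val_zero, Fin.val_succ, true_and]
      omega
    · show (pathGraph (n + 2)).Adj x.succ 0 ↔ y = () ∧ x = 0
      rw [pathGraph_adj, Fin.ext_iff]
      simp only [Fin.val_zero, Fin.val_succ, true_and]
      omega
    · show (pathGraph (n + 2)).Adj x.succ y.succ ↔ (pathGraph (n + 1)).Adj x y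
      rw [pathGraph_adj, pathGraph_adj]; simp
  let e : glue (⊥ : SimpleGraph Unit) (pathGraph (n + 1)) () 0 ≃g pathGraph (n + 2) :=
    ⟨Equiv.ofBijective F hF, hR _ _⟩
  refine ⟨e.symm, ?_⟩
  have : e (.inl ()) = 0 := rfl
  rw [← this]; exact e.symm_apply_apply _

theorem path_iso (n : ℕ) : ∃ e : pathGraph (n + 1) ≃g (prePl n).gr, e 0 = (prePl n).root := by
  induction n with
  | zero =>
    refine ⟨⟨Equiv.ofUnique (Fin 1) Unit, ?_⟩, rfl⟩
    intro a b
    have : a = b := Subsingleton.elim (α := Fin 1) _ _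
    subst this
    simp
  | succ n ih =>
    obtain ⟨e, he⟩ := ih
    obtain ⟨f, hf⟩ := path_glue n
    refine ⟨f.trans (glueCongr (x := ()) (x' := ()) Iso.refl e rfl he), ?_⟩
    show glueCongr (x := ()) (x' := ()) Iso.refl e rfl he (f 0) = _
    rw [hf]; rfl

/-! ### Spiders -/

theorem spider_glue (p q r : ℕ) : Nonempty (spider (p + 1) (q + 1) (r + 1) ≃g
    glue (glue (glue (⊥ : SimpleGraph Unit) (pathGraph (p + 1)) () 0) (pathGraph (q + 1))
      (.inl ()) 0) (pathGraph (r + 1)) (.inl (.inl ())) 0) := by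
  refine ⟨⟨⟨fun
      | .inl a => .inl (.inl (.inl a))
      | .inr (.inl a) => .inl (.inl (.inr a))
      | .inr (.inr (.inl a)) => .inl (.inr a)
      | .inr (.inr (.inr a)) => .inr a, fun
      | .inl (.inl (.inl a)) => .inl a
      | .inl (.inl (.inr a)) => .inr (.inl a)
      | .inl (.inr a) => .inr (.inr (.inl a))
      | .inr a => .inr (.inr (.inr a)), ?_, ?_⟩, ?_⟩⟩
  · rintro (a | a | a | a) <;> rfl
  · rintro (((a | a) | a) | a) <;> rfl
  · rintro (a | a | a | a) (b | b | b | b) <;>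
      simp [spider, pathGraph_adj]
    all_goals
      rw [Fin.ext_iff]
      omega

theorem spider_iso (p q r : ℕ) : Nonempty (spider (p + 1) (q + 1) (r + 1) ≃g
    (Pre.join (Pre.join (Pre.join (.one ()) (prePl p)) (prePl q)) (prePl r)).gr) := by
  obtain ⟨e⟩ := spider_glue p q r
  obtain ⟨f, hf⟩ := path_iso p
  obtain ⟨g, hg⟩ := path_iso q
  obtain ⟨h, hh⟩ := path_iso r
  exact ⟨e.trans (glueCongr (glueCongr (glueCongr (x := ()) (x' := ()) Iso.refl f rfl hf) g rfl hg)
    h rfl hh)⟩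

theorem mk_pre_s3 (p q r : ℕ) :
    RT.mk (Pre.join (Pre.join (Pre.join (.one ()) (prePl p)) (prePl q)) (prePl r)) =
      RT.s3 p q r := by
  rw [RT.mk_join, RT.mk_join, RT.mk_join, mk_prePl, mk_prePl, mk_prePl]; rfl

theorem nps_of {A : Pre Unit} (h : ¬ IsPseudopath A.gr) : RT.NPs (RT.mk A) := by
  unfold IsPseudopath at h
  push Not at h
  obtain ⟨h1, h2, h3⟩ := h
  refine ⟨?_, ?_, ?_⟩
  · intro i j hij
    obtain ⟨f⟩ := Pre.Uiso ((RT.U.of_eq hij).trans (RT.U_pp_pl j i)) A _ rfl (mk_prePl _)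
    obtain ⟨e, -⟩ := path_iso (i + j)
    exact (h1 (i + j + 1)).false (f.trans e.symm)
  · intro hU
    obtain ⟨f⟩ := Pre.Uiso hU A _ rfl (mk_pre_s3 _ _ _)
    obtain ⟨e⟩ := spider_iso 0 0 1
    exact h2.false (f.trans e.symm)
  · intro hU
    obtain ⟨f⟩ := Pre.Uiso hU A _ rfl (mk_pre_s3 _ _ _)
    obtain ⟨e⟩ := spider_iso 0 1 2
    exact h3.false (f.trans e.symm)

theorem pp_of {B : Pre Unit} {k : ℕ} (f : B.gr ≃g pathGraph k) : ∃ i j, RT.mk B = RT.pp i j := by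
  cases k with
  | zero => exact (f B.root).elim0
  | succ n =>
    obtain ⟨e, -⟩ := path_iso n
    have hU := Pre.U_of_iso (f.trans e)
    rw [mk_prePl] at hU
    obtain ⟨i, j, -, h⟩ := RT.U.pp_inv (i := n) (j := 0) hU.symm
    exact ⟨i, j, h⟩

/-! ### Weights -/
section
variable {X Y V : Type} [Fintype V] {G : SimpleGraph X} {H : SimpleGraph Y} {x : X} {y : Y}
  {T : SimpleGraph V}

theorem wt_ge (hG : G.Preconnected) (ψ : T ≃g glue G H x y) (z : Y) :
    Nat.card X ≤ wt T (ψ.symm (.inr z)) := by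
  have hmem : ∀ a : X, ψ.symm (.inl a) ∈ ({ψ.symm (.inr z)}ᶜ : Set V) := by
    intro a h
    have := ψ.symm.injective h
    exact Sum.inl_ne_inr this
  let F : G →g T.induce ({ψ.symm (.inr z)}ᶜ : Set V) :=
    ⟨fun a => ⟨ψ.symm (.inl a), hmem a⟩, by
      intro a b hab
      exact ψ.symm.map_rel_iff.2 hab⟩
  have hF : Function.Injective F := by
    intro a b h
    have : ψ.symm (.inl a) = ψ.symm (.inl b) := congrArg Subtype.val h
    exact Sum.inl_injective (ψ.symm.injective this)
  let c := (T.induce ({ψ.symm (.inr z)}ᶜ : Set V)).connectedComponentMk (F x)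
  have hc : Nat.card X ≤ Nat.card c.supp := by
    apply Nat.card_le_card_of_injective (fun a => (⟨F a, ?_⟩ : c.supp))
    · intro a b h
      exact hF (congrArg Subtype.val h)
    · rw [ConnectedComponent.mem_supp_iff, ConnectedComponent.eq]
      exact (hG a x).map F
  refine hc.trans (le_csSup ?_ ⟨c, rfl⟩)
  refine ⟨Nat.card V, ?_⟩
  rintro n ⟨d, rfl⟩
  exact Nat.card_le_card_of_injective (fun v => v.1.1)
    (Subtype.val_injective.comp Subtype.val_injective)

theorem wt_le [Finite X] [Finite Y] (ψ : T ≃g glue G H x y) :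
    wt T (ψ.symm (.inl x)) ≤ max (Nat.card X - 1) (Nat.card Y) := by
  apply csSup_le'
  rintro n ⟨c, rfl⟩
  have hstep : ∀ u v : ({ψ.symm (.inl x)}ᶜ : Set V),
      (T.induce ({ψ.symm (.inl x)}ᶜ : Set V)).Reachable u v →
      ((∃ a, ψ u.1 = .inl a) → (∃ a, ψ v.1 = .inl a)) := by
    rintro u v ⟨w⟩
    induction w with
    | nil => exact id
    | @cons u v w h p ih =>
      rintro ⟨a, ha⟩
      apply ih
      have h' : T.Adj u.1 v.1 := h
      rw [← ψ.map_rel_iff, ha] at h'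
      rcases hv : ψ v.1 with b | b
      · exact ⟨b, rfl⟩
      · rw [hv] at h'
        exfalso
        apply u.2
        show u.1 = _
        obtain ⟨rfl, -⟩ := h'
        exact ψ.injective (ha.trans (ψ.apply_symm_apply _).symm)
  induction c using ConnectedComponent.ind with
  | h u =>
    by_cases hu : ∃ a, ψ u.1 = .inl a
    · refine le_trans ?_ (le_max_left _ _)
      have hall : ∀ v : ((T.induce ({ψ.symm (.inl x)}ᶜ : Set V)).connectedComponentMk u).supp,
          ∃ a : ({x}ᶜ : Set X), ψ v.1.1 = .inl a.1 := by
        rintro ⟨v, hv⟩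
        rw [ConnectedComponent.mem_supp_iff, ConnectedComponent.eq] at hv
        obtain ⟨a, ha⟩ := hstep u v hv.symm hu
        refine ⟨⟨a, ?_⟩, ha⟩
        rintro rfl
        apply v.2
        show v.1 = _
        exact ψ.injective (ha.trans (ψ.apply_symm_apply _).symm)
      choose f hf using hall
      have hle := Nat.card_le_card_of_injective f (by
        intro v w h
        apply Subtype.ext; apply Subtype.ext
        apply ψ.injective
        rw [hf, hf, h])
      refine hle.trans ?_
      rw [Nat.card_coe_set_eq, Set.ncard_compl, Set.ncard_singleton]
    · refine le_trans ?_ (le_max_right _ _)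
      have hall : ∀ v : ((T.induce ({ψ.symm (.inl x)}ᶜ : Set V)).connectedComponentMk u).supp,
          ∃ a : Y, ψ v.1.1 = .inr a := by
        rintro ⟨v, hv⟩
        rw [ConnectedComponent.mem_supp_iff, ConnectedComponent.eq] at hv
        rcases hv' : ψ v.1 with b | b
        · exact (hu (hstep v u hv ⟨b, hv'⟩)).elim
        · exact ⟨b, rfl⟩
      choose f hf using hall
      exact Nat.card_le_card_of_injective f (by
        intro v w h
        apply Subtype.ext; apply Subtype.ext
        apply ψ.injective
        rw [hf, hf, h])

theorem card_le_of_wt [Finite X] [Finite Y] (hG : G.Preconnected) (ψ : T ≃g glue G H x y)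
    {a b : V} (ha : ψ a = .inl x) (hb : ψ b = .inr y) (h : wt T b ≤ wt T a) :
    Nat.card X ≤ Nat.card Y := by
  have ha' : a = ψ.symm (.inl x) := by rw [← ha]; exact (ψ.symm_apply_apply _).symm
  have hb' : b = ψ.symm (.inr y) := by rw [← hb]; exact (ψ.symm_apply_apply _).symm
  rw [ha', hb'] at h
  have h1 := wt_ge hG ψ y
  have h2 := wt_le ψ
  have : Nonempty X := ⟨x⟩
  have h3 := Nat.card_pos (α := X)
  omega
end

/-! ### Reconstruction from two cards -/

theorem restore {W : Type} {H : SimpleGraph W} {f : Sym2 W} (hf : f ∈ H.edgeSet) {p q : Pre Unit}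
    (χ : H.deleteEdges {f} ≃g sm p.gr q.gr) :
    (∃ p' q' : Pre Unit, RT.U (RT.mk p') (RT.mk p) ∧ RT.U (RT.mk q') (RT.mk q) ∧
      Nonempty (H ≃g (Pre.join p' q').gr)) ∨
    (∀ u v, H.Reachable u v → (H.deleteEdges {f}).Reachable u v) := by
  have good : ∀ u v, f = s(u, v) → ∀ a b, χ u = .inl a → χ v = .inr b →
      (∃ p' q' : Pre Unit, RT.U (RT.mk p') (RT.mk p) ∧ RT.U (RT.mk q') (RT.mk q) ∧
      Nonempty (H ≃g (Pre.join p' q').gr)) := by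
    rintro u v rfl a b ha hb
    obtain ⟨p', hp, g, hg⟩ := p.reroot a
    obtain ⟨q', hq, g', hg'⟩ := q.reroot b
    exact ⟨p', q', hp, hq, ⟨(addGlue hf χ ha hb).trans (glueCongr g g' hg hg').symm⟩⟩
  have bad : ∀ u v, f = s(u, v) → (H.deleteEdges {f}).Reachable u v →
      (∀ u v, H.Reachable u v → (H.deleteEdges {f}).Reachable u v) := by
    rintro u v hf' h x y ⟨w⟩
    induction w with
    | nil => exact Reachable.refl _
    | @cons x y z hxy _ ih =>
      refine Reachable.trans ?_ ih
      by_cases he : s(x, y) = f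
      · rw [hf'] at he
        rcases Sym2.eq_iff.1 he with ⟨rfl, rfl⟩ | ⟨rfl, rfl⟩
        · exact h
        · exact h.symm
      · exact Adj.reachable (by rw [deleteEdges_adj]; exact ⟨hxy, he⟩)
  induction f using Sym2.ind with
  | _ u v =>
    rcases hu : χ u with a | a <;> rcases hv : χ v with b | b
    · right
      apply bad u v rfl
      rw [← χ.reachable_iff, hu, hv]
      exact sm_reach_ll (p.gr_pre _ _)
    · exact Or.inl (good u v rfl a b hu hv)
    · exact Or.inl (good v u Sym2.eq_swap b a hv hu)
    · right
      apply bad u v rfl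
      rw [← χ.reachable_iff, hu, hv]
      exact sm_reach_rr (q.gr_pre _ _)

theorem cls_mem {W : Type} {K : SimpleGraph W} {p q : Pre Unit} (χ : K ≃g sm p.gr q.gr) (u : W) :
    {v | K.Reachable u v}.ncard = RT.sz (RT.mk p) ∨
    {v | K.Reachable u v}.ncard = RT.sz (RT.mk q) := by
  rw [← Pre.card_Vt, ← Pre.card_Vt]
  rcases hu : χ u with a | a
  · exact Or.inl (cls_left p.gr_pre χ hu)
  · exact Or.inr (cls_right q.gr_pre χ hu)

theorem cls_ex {W : Type} {K : SimpleGraph W} {p q : Pre Unit} (χ : K ≃g sm p.gr q.gr) :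
    ∃ u, {v | K.Reachable u v}.ncard = RT.sz (RT.mk p) := by
  refine ⟨χ.symm (.inl p.root), ?_⟩
  rw [← Pre.card_Vt]
  exact cls_left p.gr_pre χ (χ.apply_symm_apply _)

theorem cls_conn {W : Type} {K : SimpleGraph W} {p : Pre Unit} (χ : K ≃g p.gr) (u : W) :
    {v | K.Reachable u v}.ncard = RT.sz (RT.mk p) := by
  have : {v | K.Reachable u v} = Set.univ := by
    ext v
    simp only [Set.mem_ofPred_eq, Set.mem_univ, iff_true]
    rw [← χ.reachable_iff]
    exact p.gr_pre _ _
  rw [this, Set.ncard_univ, ← Pre.card_Vt]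
  exact Nat.card_congr χ.toEquiv

theorem cls_eq {W : Type} {H : SimpleGraph W} {f : Sym2 W}
    (h : ∀ u v, H.Reachable u v → (H.deleteEdges {f}).Reachable u v) (u : W) :
    {v | H.Reachable u v}.ncard = {v | (H.deleteEdges {f}).Reachable u v}.ncard := by
  congr 1
  ext v
  exact ⟨h u v, fun h' => h'.mono (deleteEdges_le _)⟩

theorem sz_pos (p : Pre Unit) : 0 < RT.sz (RT.mk p) := by
  rw [← Pre.card_Vt]
  have : Nonempty (Pre.Vt p) := ⟨p.root⟩
  exact Nat.card_pos

theorem rep_mk (R : RT Unit) : ∃ p, RT.mk p = R := Quot.exists_rep R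

theorem ern_two_mem {V : Type} {T : SimpleGraph V} {p : Pre Unit} (τ : T ≃g p.gr)
    (hA : RT.Alg (RT.mk p)) :
    ∃ s : Finset (Sym2 V), s.card = 2 ∧ (↑s : Set (Sym2 V)) ⊆ T.edgeSet ∧
    ∀ (W : Type) (_ : Fintype W) (H : SimpleGraph W) (t : Finset (Sym2 W)),
      (↑t : Set (Sym2 W)) ⊆ H.edgeSet →
      (∃ φ : {e // e ∈ s} ≃ {f // f ∈ t},
        ∀ e : {e // e ∈ s},
          Nonempty (H.deleteEdges {(φ e).1} ≃g T.deleteEdges {e.1})) →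
      Nonempty (H ≃g T) := by
  classical
  obtain ⟨A1, B1, A2, B2, hU1, hU2, hne1, hne2, hmain⟩ := hA
  obtain ⟨A1, rfl⟩ := rep_mk A1
  obtain ⟨B1, rfl⟩ := rep_mk B1
  obtain ⟨A2, rfl⟩ := rep_mk A2
  obtain ⟨B2, rfl⟩ := rep_mk B2
  have hsz1 := hU1.sz
  have hsz2 := hU2.sz
  rw [RT.sz_join] at hsz1 hsz2
  obtain ⟨g1⟩ := Pre.Uiso hU1 p (.join A1 B1) rfl rfl
  obtain ⟨g2⟩ := Pre.Uiso hU2 p (.join A2 B2) rfl rfl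
  have card : ∀ (A B : Pre Unit), p.gr ≃g (Pre.join A B).gr → ∃ e ∈ T.edgeSet,
      Nonempty (T.deleteEdges {e} ≃g sm A.gr B.gr) := by
    intro A B g
    let ψ : T ≃g glue A.gr B.gr A.root B.root := τ.trans g
    refine ⟨s(ψ.symm (.inl A.root), ψ.symm (.inr B.root)), ?_,
      ⟨delGlue ψ (ψ.apply_symm_apply _) (ψ.apply_symm_apply _)⟩⟩
    rw [mem_edgeSet, ψ.symm.map_rel_iff]
    exact ⟨rfl, rfl⟩
  obtain ⟨e1, he1, ⟨χ1⟩⟩ := card A1 B1 g1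
  obtain ⟨e2, he2, ⟨χ2⟩⟩ := card A2 B2 g2
  have hne : e1 ≠ e2 := by
    rintro rfl
    obtain ⟨u, hu⟩ := cls_ex χ1
    rcases cls_mem χ2 u with h | h
    · exact hne1 (hu.symm.trans h)
    · exact hne2 (hu.symm.trans h)
  refine ⟨{e1, e2}, Finset.card_pair hne, ?_, ?_⟩
  · intro e he
    simp only [Finset.coe_insert, Finset.coe_singleton, Set.mem_insert_iff,
      Set.mem_singleton_iff] at he
    rcases he with rfl | rfl
    · exact he1
    · exact he2
  · rintro W _ H t ht ⟨φ, hφ⟩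
    obtain ⟨χ1'⟩ := hφ ⟨e1, by simp⟩
    obtain ⟨χ2'⟩ := hφ ⟨e2, by simp⟩
    have hf1 := ht (φ ⟨e1, by simp⟩).2
    have hf2 := ht (φ ⟨e2, by simp⟩).2
    generalize (φ ⟨e1, by simp⟩).1 = f1 at χ1' hf1
    generalize (φ ⟨e2, by simp⟩).1 = f2 at χ2' hf2
    replace χ1 := χ1'.trans χ1
    replace χ2 := χ2'.trans χ2
    rcases restore hf1 χ1 with ⟨A1', B1', ha1, hb1, ⟨j1⟩⟩ | bad1 <;>
    rcases restore hf2 χ2 with ⟨A2', B2', ha2, hb2, ⟨j2⟩⟩ | bad2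
    · have hU := hmain _ _ _ _ ha1 hb1 ha2 hb2 (Pre.U_of_iso (j1.symm.trans j2))
      obtain ⟨j⟩ := Pre.Uiso hU (.join A1' B1') p rfl rfl
      exact ⟨(j1.trans j).trans τ.symm⟩
    · exfalso
      obtain ⟨u, hu⟩ := cls_ex χ2
      rw [← cls_eq bad2, cls_conn j1, RT.mk_join, RT.sz_join, ha1.sz, hb1.sz] at hu
      have : 0 < RT.sz (RT.mk B2) := sz_pos B2
      change RT.sz (RT.mk A1) + RT.sz (RT.mk B1) = RT.sz (RT.mk A2) at hu
      omega
    · exfalso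
      obtain ⟨u, hu⟩ := cls_ex χ1
      rw [← cls_eq bad1, cls_conn j2, RT.mk_join, RT.sz_join, ha2.sz, hb2.sz] at hu
      have : 0 < RT.sz (RT.mk B1) := sz_pos B1
      change RT.sz (RT.mk A2) + RT.sz (RT.mk B2) = RT.sz (RT.mk A1) at hu
      omega
    · exfalso
      obtain ⟨u, hu⟩ := cls_ex χ1
      rw [← cls_eq bad1, cls_eq bad2] at hu
      rcases cls_mem χ2 u with h | h
      · exact hne1 (hu.symm.trans h)
      · exact hne2 (hu.symm.trans h)

theorem one_card {V X Y : Type} [Finite X] [Finite Y] {T : SimpleGraph V} (hT : T.IsTree)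
    {e : Sym2 V} {G : SimpleGraph X} {H : SimpleGraph Y} (χ : T.deleteEdges {e} ≃g sm G H)
    {x y : X} (hxy : x ≠ y) (hadj : ¬ G.Adj x y) (z : Y)
    (h : ∀ (W : Type) (_ : Fintype W) (H : SimpleGraph W) (t : Finset (Sym2 W)),
      (↑t : Set (Sym2 W)) ⊆ H.edgeSet →
      (∃ φ : {e' // e' ∈ ({e} : Finset (Sym2 V))} ≃ {f // f ∈ t},
        ∀ e' : {e' // e' ∈ ({e} : Finset (Sym2 V))},
          Nonempty (H.deleteEdges {(φ e').1} ≃g T.deleteEdges {e'.1})) →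
      Nonempty (H ≃g T)) : False := by
  let K : SimpleGraph (X ⊕ Y) := sm (G ⊔ edge x y) H
  have hK : K.deleteEdges {s(.inl x, .inl y)} = sm G H := by
    ext u v
    rw [deleteEdges_adj]
    rcases u with u | u <;> rcases v with v | v
    · simp only [K, sm_ll, sup_adj, edge_adj, Set.mem_singleton_iff, Sym2.eq_iff, Sum.inl.injEq]
      constructor
      · tauto
      · intro h'
        refine ⟨Or.inl h', ?_⟩
        rintro (⟨rfl, rfl⟩ | ⟨rfl, rfl⟩)
        · exact hadj h'
        · exact hadj h'.symm
    · simp [K]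
    · simp [K]
    · simp [K]
  obtain ⟨f⟩ := h (X ⊕ Y) (Fintype.ofFinite _) K {s(.inl x, .inl y)} (by
    intro f hf
    simp only [Finset.coe_singleton, Set.mem_singleton_iff] at hf
    subst hf
    rw [mem_edgeSet]
    simp [K, edge_adj, hxy]) ⟨Equiv.ofUnique _ _, by
      rintro ⟨e', he'⟩
      obtain rfl := Finset.mem_singleton.1 he'
      have : ∀ g : {f // f ∈ ({s(.inl x, .inl y)} : Finset (Sym2 (X ⊕ Y)))},
          g.1 = s(.inl x, .inl y) := fun g => Finset.mem_singleton.1 g.2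
      rw [this, hK]
      exact ⟨χ.symm⟩⟩
  have hr : K.Reachable (.inl x) (.inr z) := by
    rw [← f.reachable_iff]
    exact hT.connected.preconnected _ _
  obtain ⟨b, hb⟩ := sm_reach_left hr
  exact Sum.inl_ne_inr hb.symm

theorem exists_nonadj {p : Pre Unit} (h : 3 ≤ Nat.card p.Vt) :
    ∃ x y : p.Vt, x ≠ y ∧ ¬ p.gr.Adj x y := by
  have aux : ∀ q : Pre Unit, 2 ≤ Nat.card q.Vt → ∃ x : q.Vt, x ≠ q.root := by
    intro q hq
    have : Nontrivial q.Vt := Finite.one_lt_card_iff_nontrivial.1 hq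
    exact exists_ne _
  cases p with
  | one c =>
    exfalso
    have : Nat.card Unit = 1 := Nat.card_unique
    change 3 ≤ Nat.card Unit at h
    omega
  | join A B =>
    change 3 ≤ Nat.card (A.Vt ⊕ B.Vt) at h
    rw [Nat.card_sum] at h
    by_cases hA : 2 ≤ Nat.card A.Vt
    · obtain ⟨x, hx⟩ := aux A hA
      exact ⟨(Sum.inl x : A.Vt ⊕ B.Vt), (Sum.inr B.root : A.Vt ⊕ B.Vt),
        Sum.inl_ne_inr, fun h' => hx (show x = A.root ∧ B.root = B.root from h').1⟩
    · obtain ⟨x, hx⟩ := aux B (by omega)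
      exact ⟨(Sum.inl A.root : A.Vt ⊕ B.Vt), (Sum.inr x : A.Vt ⊕ B.Vt),
        Sum.inl_ne_inr, fun h' => hx (show A.root = A.root ∧ x = B.root from h').2⟩

/-- The set whose infimum is the edge-reconstruction number. -/
def ernSet {V : Type} (G : SimpleGraph V) : Set ℕ :=
  {k | ∃ s : Finset (Sym2 V), s.card = k ∧ (↑s : Set (Sym2 V)) ⊆ G.edgeSet ∧
    ∀ (W : Type) (_ : Fintype W) (H : SimpleGraph W) (t : Finset (Sym2 W)),
      (↑t : Set (Sym2 W)) ⊆ H.edgeSet →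
      (∃ φ : {e // e ∈ s} ≃ {f // f ∈ t},
        ∀ e : {e // e ∈ s},
          Nonempty (H.deleteEdges {(φ e).1} ≃g G.deleteEdges {e.1})) →
      Nonempty (H ≃g G)}

theorem ern_eq_two {V : Type} [Fintype V] {T : SimpleGraph V} (hT : T.IsTree)
    (hc : 5 ≤ Nat.card V) {p : Pre Unit} (τ : T ≃g p.gr) (hA : RT.Alg (RT.mk p)) : ern T = 2 := by
  have h2 : 2 ∈ ernSet T := ern_two_mem τ hA
  have hle : ern T ≤ 2 := Nat.sInf_le h2
  obtain ⟨s, hs, hsub, hrec⟩ := Nat.sInf_mem (s := ernSet T) ⟨2, h2⟩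
  change s.card = ern T at hs
  have h0 : ern T ≠ 0 := by
    intro h
    rw [h, Finset.card_eq_zero] at hs
    subst hs
    obtain ⟨f⟩ := hrec Empty inferInstance ⊥ ∅ (by simp) ⟨Equiv.equivOfIsEmpty _ _, by
      rintro ⟨e, he⟩; simp at he⟩
    obtain ⟨v⟩ := hT.connected.nonempty
    exact (f.symm v).elim
  have h1 : ern T ≠ 1 := by
    intro h
    rw [h, Finset.card_eq_one] at hs
    obtain ⟨e, rfl⟩ := hs
    have he : e ∈ T.edgeSet := hsub (by simp)
    induction e using Sym2.ind with
    | _ u v =>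
      obtain ⟨A, B, ψ, ha, hb⟩ := tree_split T hT he
      have hcard := Nat.card_congr ψ.toEquiv
      rw [Nat.card_sum] at hcard
      by_cases h3 : 3 ≤ Nat.card A.Vt
      · obtain ⟨x, y, hxy, hadj⟩ := exists_nonadj h3
        exact one_card hT (delGlue ψ ha hb) hxy hadj B.root hrec
      · obtain ⟨x, y, hxy, hadj⟩ := exists_nonadj (p := B) (by omega)
        exact one_card hT ((delGlue ψ ha hb).trans (smComm _ _)) hxy hadj A.root hrec
  omega

/-- If `T` is a bicentroidal tree one of whose centroidal components is a path `P_k` while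
the other centroidal component is not a pseudopath, then `ern(T) = 2`. -/
theorem stmt14 {V : Type} [Fintype V] (T : SimpleGraph V) (hT : T.IsTree)
    (a b : V) (hab : T.Adj a b) (hcent : centroid T = {a, b}) (k : ℕ)
    (hHb : Nonempty
      ((T.deleteEdges {s(a, b)}).induce
        ((T.deleteEdges {s(a, b)}).connectedComponentMk b).supp ≃g pathGraph k))
    (hGa : ¬ IsPseudopath
      ((T.deleteEdges {s(a, b)}).induce
        ((T.deleteEdges {s(a, b)}).connectedComponentMk a).supp)) :
    ern T = 2 := by
  obtain ⟨A, B, ψ, ha, hb⟩ := tree_split T hT hab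
  let χ := delGlue ψ ha hb
  obtain ⟨fa⟩ := comp_iso A.gr_pre χ ha
  obtain ⟨fb⟩ := comp_iso B.gr_pre (χ.trans (smComm _ _)) (a := b) (x := B.root) (by
    show smComm A.gr B.gr (ψ b) = _
    rw [hb]; rfl)
  obtain ⟨fk⟩ := hHb
  obtain ⟨i, j, hB⟩ := pp_of (fb.symm.trans fk)
  have hNPs : RT.NPs (RT.mk A) := by
    apply nps_of
    intro h
    apply hGa
    rcases h with ⟨n, ⟨f⟩⟩ | ⟨⟨f⟩⟩ | ⟨⟨f⟩⟩
    · exact Or.inl ⟨n, ⟨fa.trans f⟩⟩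
    · exact Or.inr (Or.inl ⟨fa.trans f⟩)
    · exact Or.inr (Or.inr ⟨fa.trans f⟩)
  have hac : a ∈ centroid T := by rw [hcent]; simp
  have hbc : b ∈ centroid T := by rw [hcent]; simp
  have c1 := card_le_of_wt A.gr_pre ψ ha hb (hbc a)
  have c2 := card_le_of_wt B.gr_pre (ψ.trans (glueComm _ _ _ _)) (a := b) (b := a)
    (by show glueComm A.gr B.gr A.root B.root (ψ b) = _
        rw [hb]; rfl)
    (by show glueComm A.gr B.gr A.root B.root (ψ a) = _
        rw [ha]; rfl) (hac b)
  have hsize : RT.sz (RT.mk A) = RT.sz (RT.mk B) := by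
    rw [← Pre.card_Vt, ← Pre.card_Vt]; omega
  have h4 := RT.nps_size hNPs
  have hcard := Nat.card_congr ψ.toEquiv
  rw [Nat.card_sum, Pre.card_Vt, Pre.card_Vt] at hcard
  refine ern_eq_two hT (by omega) (p := .join A B) ψ ?_
  rw [RT.mk_join, hB]
  exact RT.alg_main hNPs (by rw [hsize, hB])

end ErnPaper
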